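/- arXiv:2007.09962 — 5 statements merged into one kernel-verified Lean document; each statement's English description precedes it below -/
import Mathlib

section
/- Fix n ∈ ℕ. Let T be a ternary form of degree d = 8+2n with a decomposition A = {P_1,…,P_r} ⊂ ℙ^2 of length r ≤ 11+3n. If there is a subset A' ⊆ A with ℓ(A') ≥ 5+n whose points all lie on a line, then T admits infinitely many pairwise distinct decompositions of length r (a positive-dimensional family {A_t} of decompositions of T with A_0 = A). -/
open MvPolynomial
open scoped Classical

noncomputable section

/-- Points of the projective space `ℙ^m` over `ℂ`. -/
abbrev Pt (m : ℕ) := Projectivization ℂ (Fin (m + 1) → ℂ)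

/-- The linear form with coefficient vector `v`. -/
def linForm {m : ℕ} (v : Fin (m + 1) → ℂ) : MvPolynomial (Fin (m + 1)) ℂ :=
  ∑ i, C (v i) * X i

/-- The degree-`d` Veronese image of a projective point, i.e. the `d`-th power `L^d`
of a linear form `L` representing the point. -/
def powRep {m : ℕ} (d : ℕ) (P : Pt m) : MvPolynomial (Fin (m + 1)) ℂ :=
  linForm P.rep ^ d

/-- `A ⊆ ℙ^m` is a decomposition of the form `T` of degree `d`:
`T = a_1 L_1^d + ⋯ + a_r L_r^d`. -/
def IsDecomp {m : ℕ} (d : ℕ) (A : Finset (Pt m))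
    (T : MvPolynomial (Fin (m + 1)) ℂ) : Prop :=
  ∃ a : Pt m → ℂ, T = ∑ P ∈ A, a P • powRep d P

/-- A decomposition is non-redundant if `T` is not in the span of `ν_d(A')`
for any proper subset `A' ⊊ A`. -/
def NonRedundant {m : ℕ} (d : ℕ) (A : Finset (Pt m))
    (T : MvPolynomial (Fin (m + 1)) ℂ) : Prop :=
  ∀ A' : Finset (Pt m), A' ⊂ A →
    T ∉ Submodule.span ℂ (powRep d '' (A' : Set (Pt m)))

/-- The Cayley–Bacharach property `CB(d)`. -/
def CB {m : ℕ} (d : ℕ) (Z : Finset (Pt m)) : Prop :=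
  ∀ P ∈ Z, ∀ F : MvPolynomial (Fin (m + 1)) ℂ, F.IsHomogeneous d →
    (∀ Q ∈ Z.erase P, eval Q.rep F = 0) → eval P.rep F = 0

/-- The `d`-th Kruskal rank of a finite set `Z ⊂ ℙ^m`: the largest `k` (at most `ℓ(Z)`)
such that the Veronese images of every subset of `Z` of cardinality at most `k`
are linearly independent. -/
def kruskalRank {m : ℕ} (d : ℕ) (Z : Finset (Pt m)) : ℕ :=
  sSup {k | k ≤ Z.card ∧ ∀ S ⊆ Z, S.card ≤ k →
    LinearIndependent ℂ (fun P : S => powRep d P.1)}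

/-- The evaluation map of degree `d` on (representatives of) the points of `Z`. -/
def evalMap {m : ℕ} (Z : Finset (Pt m)) (d : ℕ) :
    homogeneousSubmodule (Fin (m + 1)) ℂ d →ₗ[ℂ] (Z → ℂ) where
  toFun F P := eval (P : Pt m).rep F.1
  map_add' F G := by funext P; simp
  map_smul' c F := by funext P; simp [smul_eq_C_mul]

/-- The Hilbert function of a finite set of points `Z ⊂ ℙ^m`. -/
def hf {m : ℕ} (Z : Finset (Pt m)) (d : ℕ) : ℕ :=
  Module.finrank ℂ (LinearMap.range (evalMap Z d))

/-- The first difference of the Hilbert function (with `h_Z(j) = 0` for `j < 0`). -/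
def Dhf {m : ℕ} (Z : Finset (Pt m)) (j : ℕ) : ℤ :=
  if j = 0 then (hf Z 0 : ℤ) else (hf Z j : ℤ) - (hf Z (j - 1) : ℤ)

lemma exists_ker (s : ℕ) (hs : 2 ≤ s) (φ : Polynomial ℂ →ₗ[ℂ] ℂ) :
    ∃ g : Polynomial ℂ, g ≠ 0 ∧ g.degree < s ∧
      ∀ h : Polynomial ℂ, h.natDegree ≤ s - 2 → φ (g * h) = 0 := by
  let M : Polynomial.degreeLT ℂ s →ₗ[ℂ] (Fin (s - 1) → ℂ) :=
    LinearMap.pi fun j => φ ∘ₗ (LinearMap.mulRight ℂ (Polynomial.X ^ (j : ℕ))) ∘ₗ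
      (Polynomial.degreeLT ℂ s).subtype
  have hfd : FiniteDimensional ℂ (Polynomial.degreeLT ℂ s) :=
    (Polynomial.degreeLTEquiv ℂ s).symm.finiteDimensional
  have hk : LinearMap.ker M ≠ ⊥ := by
    apply LinearMap.ker_ne_bot_of_finrank_lt
    rw [(Polynomial.degreeLTEquiv ℂ s).finrank_eq]
    simp; omega
  obtain ⟨g, hg, hg0⟩ := Submodule.exists_mem_ne_zero_of_ne_bot hk
  refine ⟨g.1, by simpa using hg0, Polynomial.mem_degreeLT.1 g.2, fun h hh => ?_⟩
  have hj : ∀ j < s - 1, φ (g.1 * Polynomial.X ^ j) = 0 := fun j hj =>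
    congrFun (LinearMap.mem_ker.1 hg) ⟨j, hj⟩
  rw [h.as_sum_range' (s - 1) (by omega), Finset.mul_sum, map_sum]
  refine Finset.sum_eq_zero fun j hj' => ?_
  rw [← Polynomial.C_mul_X_pow_eq_monomial, mul_left_comm, ← Polynomial.smul_eq_C_mul, map_smul,
    hj j (Finset.mem_range.1 hj'), smul_zero]

lemma quadrature (s : ℕ) (φ : Polynomial ℂ →ₗ[ℂ] ℂ) (hs : 2 ≤ s)
    (F : Polynomial ℂ) (hF : F.Monic) (hd : F.natDegree = s) (R : Finset ℂ) (hR : R.card = s)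
    (hroot : ∀ x ∈ R, F.eval x = 0)
    (h0 : ∀ h : Polynomial ℂ, h.natDegree ≤ s - 2 → φ (F * h) = 0) :
    ∃ b : ℂ → ℂ, ∀ p : Polynomial ℂ, p.natDegree ≤ 2 * s - 2 →
      φ p = ∑ x ∈ R, b x * p.eval x := by
  refine ⟨fun x => φ (Lagrange.basis R id x), fun p hp => ?_⟩
  have hdiv := Polynomial.modByMonic_add_div p F
  have hq : (p /ₘ F).natDegree ≤ s - 2 := by
    rw [Polynomial.natDegree_divByMonic p hF]; omega
  have hr : (p %ₘ F).degree < R.card := by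
    have := Polynomial.degree_modByMonic_lt p hF
    rwa [Polynomial.degree_eq_natDegree hF.ne_zero, hd, ← hR] at this
  have hr2 := Lagrange.eq_interpolate (v := id) (s := R) Function.injective_id.injOn hr
  have h1 : φ p = φ (p %ₘ F) := by
    conv_lhs => rw [← hdiv]
    rw [map_add, h0 _ hq, add_zero]
  rw [h1, hr2, Lagrange.interpolate_apply, map_sum]
  refine Finset.sum_congr rfl fun x hx => ?_
  rw [← Polynomial.smul_eq_C_mul, map_smul, smul_eq_mul, mul_comm]
  congr 1
  conv_rhs => rw [← hdiv]
  simp [hroot x hx]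

lemma pencil (s : ℕ) (hs : 2 ≤ s) (t : Finset ℂ) (ht : t.card = s) (a : ℂ → ℂ)
    (E : Finset ℂ) (hE : Disjoint E t) :
    ∃ S : Set (Finset ℂ), S.Infinite ∧ ∀ R ∈ S, R.card = s ∧ Disjoint R E ∧
      ∃ b : ℂ → ℂ, ∀ p : Polynomial ℂ, p.natDegree ≤ 2 * s - 2 →
        ∑ x ∈ t, a x * p.eval x = ∑ x ∈ R, b x * p.eval x := by
  let φ : Polynomial ℂ →ₗ[ℂ] ℂ := ∑ x ∈ t, a x • Polynomial.leval x
  have hφ : ∀ p, φ p = ∑ x ∈ t, a x * p.eval x := fun p => by simp [φ]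
  obtain ⟨g, hg0, hgd, hg⟩ := exists_ker s hs φ
  let f : Polynomial ℂ := ∏ x ∈ t, (Polynomial.X - Polynomial.C x)
  have hfm : f.Monic := Polynomial.monic_prod_of_monic _ _ fun x _ => Polynomial.monic_X_sub_C x
  have hfd : f.natDegree = s := by simp [f, ht]
  have hfdeg : f.degree = s := by rw [Polynomial.degree_eq_natDegree hfm.ne_zero, hfd]
  have hfsep : f.Separable := by
    apply Polynomial.separable_prod_X_sub_C_iff'.2
    intro x _ y _ h; exact h
  have hfx : ∀ x, f.eval x = 0 ↔ x ∈ t := fun x => by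
    simp [f, Polynomial.eval_prod, Finset.prod_eq_zero_iff, sub_eq_zero]
  have hff : ∀ h, φ (f * h) = 0 := fun h => by
    rw [hφ]
    exact Finset.sum_eq_zero fun x hx => by simp [(hfx x).2 hx]
  let F : ℂ → Polynomial ℂ := fun l => f + Polynomial.C l * g
  have hlg : ∀ l, (Polynomial.C l * g).degree < f.degree := fun l => by
    rw [hfdeg]
    refine lt_of_le_of_lt ?_ hgd
    rw [← Polynomial.smul_eq_C_mul]
    exact Polynomial.degree_smul_le _ _
  have hFm : ∀ l, (F l).Monic := fun l => hfm.add_of_left (hlg l)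
  have hFd : ∀ l, (F l).natDegree = s := fun l => by
    rw [← hfd]; exact Polynomial.natDegree_add_eq_left_of_degree_lt (hlg l)
  have hF0 : ∀ l, ∀ h : Polynomial ℂ, h.natDegree ≤ s - 2 → φ (F l * h) = 0 := fun l h hh => by
    simp only [F]
    rw [add_mul, map_add, hff, mul_assoc, ← Polynomial.smul_eq_C_mul, map_smul, hg h hh]; simp
  -- bad parameters
  let W := f * g.derivative - f.derivative * g
  have hW : W ≠ 0 := by
    intro hW
    have h1 : f ∣ f.derivative * g := ⟨g.derivative, (sub_eq_zero.1 hW).symm⟩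
    have h2 : f ∣ g := IsCoprime.dvd_of_dvd_mul_left hfsep h1
    have := Polynomial.degree_le_of_dvd h2 hg0
    rw [hfdeg] at this
    exact absurd hgd (not_lt.2 this)
  let bad : Finset ℂ := W.roots.toFinset.image (fun x => - f.eval x / g.eval x) ∪
    W.roots.toFinset.image (fun x => - f.derivative.eval x / g.derivative.eval x) ∪
    E.image (fun x => - f.eval x / g.eval x)
  have hnd : ∀ l ∉ bad, (F l).roots.Nodup := by
    intro l hl
    by_contra hn
    obtain ⟨x, hx⟩ := Multiset.nodup_iff_count_le_one.not.1 hn |> not_forall.1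
    rw [Polynomial.count_roots, not_le, Polynomial.one_lt_rootMultiplicity_iff_isRoot (hFm l).ne_zero] at hx
    obtain ⟨hx1, hx2⟩ := hx
    have hx1 : f.eval x + l * g.eval x = 0 := by simpa [F, Polynomial.IsRoot] using hx1
    have hx2 : f.derivative.eval x + l * g.derivative.eval x = 0 := by
      simpa [F, Polynomial.IsRoot] using hx2
    have hxW : x ∈ W.roots.toFinset := by
      simp only [Multiset.mem_toFinset, Polynomial.mem_roots hW, Polynomial.IsRoot, W]
      simp only [Polynomial.eval_sub, Polynomial.eval_mul]
      linear_combination g.derivative.eval x * hx1 - g.eval x * hx2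
    apply hl
    by_cases hgx : g.eval x = 0
    · by_cases hgx' : g.derivative.eval x = 0
      · exfalso
        obtain ⟨u, v, huv⟩ := hfsep
        have := congrArg (Polynomial.eval x) huv
        simp only [Polynomial.eval_add, Polynomial.eval_mul, Polynomial.eval_one] at this
        rw [hgx, mul_zero, add_zero] at hx1
        rw [hgx', mul_zero, add_zero] at hx2
        simp [hx1, hx2] at this
      · simp only [bad, Finset.mem_union]
        refine Or.inl (Or.inr (Finset.mem_image.2 ⟨x, hxW, ?_⟩))
        field_simp; linear_combination -hx2
    · simp only [bad, Finset.mem_union]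
      refine Or.inl (Or.inl (Finset.mem_image.2 ⟨x, hxW, ?_⟩))
      field_simp; linear_combination -hx1
  refine ⟨(fun l => (F l).roots.toFinset) '' ((bad : Set ℂ)ᶜ), ?_, ?_⟩
  · refine Set.Infinite.image ?_ (bad.finite_toSet.infinite_compl)
    intro l hl m hm hlm
    have key : ∀ l ∉ bad, F l = ∏ x ∈ (F l).roots.toFinset, (Polynomial.X - Polynomial.C x) := by
      intro l hl
      rw [Finset.prod_eq_multiset_prod, Multiset.toFinset_val, (hnd l hl).dedup]
      exact (IsAlgClosed.splits (F l)).eq_prod_roots_of_monic (hFm l)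
    have h1 : F l = F m := by
      rw [key l (by simpa using hl), key m (by simpa using hm)]
      simp only at hlm
      rw [hlm]
    have h2 : Polynomial.C l * g = Polynomial.C m * g := add_left_cancel h1
    exact Polynomial.C_injective (mul_right_cancel₀ hg0 h2)
  · rintro _ ⟨l, hl, rfl⟩
    have hl : l ∉ bad := by simpa using hl
    have hcard : (F l).roots.toFinset.card = s := by
      rw [Multiset.toFinset_card_of_nodup (hnd l hl), ← hFd l]
      exact ((IsAlgClosed.splits (F l)).natDegree_eq_card_roots).symm
    refine ⟨hcard, ?_, ?_⟩
    · rw [Finset.disjoint_left]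
      intro x hx hxE
      have hx : f.eval x + l * g.eval x = 0 := by
        have := (Polynomial.mem_roots (hFm l).ne_zero).1 (Multiset.mem_toFinset.1 hx)
        simpa [F, Polynomial.IsRoot] using this
      have hft : f.eval x ≠ 0 := fun h => Finset.disjoint_left.1 hE hxE ((hfx x).1 h)
      apply hl
      simp only [bad, Finset.mem_union]
      refine Or.inr (Finset.mem_image.2 ⟨x, hxE, ?_⟩)
      have : g.eval x ≠ 0 := by
        intro h; apply hft; simpa [h] using hx
      field_simp; linear_combination -hx
    · obtain ⟨b, hb⟩ := quadrature s φ hs (F l) (hFm l) (hFd l) _ hcard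
        (fun x hx => (Polynomial.mem_roots (hFm l).ne_zero).1 (Multiset.mem_toFinset.1 hx)) (hF0 l)
      exact ⟨b, fun p hp => by rw [← hφ, hb p hp]⟩

lemma linForm_add' {m : ℕ} (u v : Fin (m + 1) → ℂ) (x : ℂ) :
    linForm (u + x • v) = linForm u + C x * linForm v := by
  simp only [linForm, Finset.mul_sum, ← Finset.sum_add_distrib]
  refine Finset.sum_congr rfl fun i _ => ?_
  simp; ring

lemma linForm_smul' {m : ℕ} (u : Fin (m + 1) → ℂ) (x : ℂ) :
    linForm (x • u) = C x * linForm u := by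
  simp only [linForm, Finset.mul_sum]
  refine Finset.sum_congr rfl fun i _ => ?_
  simp; ring

lemma powRep_mk {m : ℕ} (d : ℕ) (w : Fin (m + 1) → ℂ) (hw : w ≠ 0) :
    ∃ c : ℂ, c ≠ 0 ∧ powRep d (Projectivization.mk ℂ w hw) = c • linForm w ^ d := by
  obtain ⟨a, ha⟩ := Projectivization.exists_smul_eq_mk_rep ℂ w hw
  refine ⟨(a : ℂ) ^ d, pow_ne_zero _ a.ne_zero, ?_⟩
  rw [powRep, ← ha, Units.smul_def, linForm_smul', mul_pow, smul_eq_C_mul, C_pow]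

lemma isDecomp_iff {m : ℕ} (d : ℕ) (A : Finset (Pt m)) (T : MvPolynomial (Fin (m + 1)) ℂ) :
    IsDecomp d A T ↔ T ∈ Submodule.span ℂ (powRep d '' (A : Set (Pt m))) := by
  rw [Submodule.mem_span_image_finset_iff_exists_fun]
  constructor
  · rintro ⟨a, h⟩
    refine ⟨fun P => a P, ?_⟩
    rw [h, ← Finset.sum_coe_sort A]
  · rintro ⟨a, h⟩
    refine ⟨fun P => if hP : P ∈ A then a ⟨P, hP⟩ else 0, ?_⟩
    rw [← h, ← Finset.sum_coe_sort A]
    exact Finset.sum_congr rfl fun P _ => by simp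

/-- transfer of moment identities to power sums -/
lemma transfer (d : ℕ) (t R : Finset ℂ) (a b : ℂ → ℂ)
    (h : ∀ p : Polynomial ℂ, p.natDegree ≤ d →
        ∑ x ∈ t, a x * p.eval x = ∑ x ∈ R, b x * p.eval x)
    (U V : MvPolynomial (Fin 3) ℂ) :
    ∑ x ∈ t, a x • (U + C x * V) ^ d = ∑ x ∈ R, b x • (U + C x * V) ^ d := by
  have key : ∀ (t : Finset ℂ) (a : ℂ → ℂ), ∑ x ∈ t, a x • (U + C x * V) ^ d =
      ∑ k ∈ Finset.range (d + 1), C (∑ x ∈ t, a x * (Polynomial.X ^ (d - k) : Polynomial ℂ).eval x) *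
        (U ^ k * V ^ (d - k) * (d.choose k : MvPolynomial (Fin 3) ℂ)) := by
    intro t a
    simp only [map_sum, Finset.sum_mul]
    rw [Finset.sum_comm]
    refine Finset.sum_congr rfl fun x _ => ?_
    rw [add_pow, smul_eq_C_mul, Finset.mul_sum]
    refine Finset.sum_congr rfl fun k _ => ?_
    simp [mul_pow]; ring
  rw [key, key]
  refine Finset.sum_congr rfl fun k _ => ?_
  rw [h]
  simp

/-- affine coordinates on a line avoiding finitely many points -/
lemma line_coords (L : MvPolynomial (Fin 3) ℂ) (hL0 : L ≠ 0) (hL : L.IsHomogeneous 1)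
    (A : Finset (Pt 2)) (hA : ∀ P ∈ A, eval P.rep L = 0) :
    ∃ u v : Fin 3 → ℂ, LinearIndependent ℂ ![u, v] ∧
      ∀ P ∈ A, ∃ c x : ℂ, c ≠ 0 ∧ P.rep = c • (u + x • v) := by
  have hlin : ∃ φ : (Fin 3 → ℂ) →ₗ[ℂ] ℂ, ∀ w, φ w = eval w L := by
    have : L ∈ homogeneousSubmodule (Fin 3) ℂ 1 := hL
    rw [homogeneousSubmodule_one_eq_span_X] at this
    clear hL0 hL hA
    induction this using Submodule.span_induction with
    | mem x hx => obtain ⟨i, rfl⟩ := hx; exact ⟨LinearMap.proj i, fun w => by simp⟩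
    | zero => exact ⟨0, fun w => by simp⟩
    | add x y _ _ hx hy =>
      obtain ⟨p, hp⟩ := hx
      obtain ⟨q, hq⟩ := hy
      exact ⟨p + q, fun w => by simp [hp, hq]⟩
    | smul c x _ hx =>
      obtain ⟨p, hp⟩ := hx
      exact ⟨c • p, fun w => by simp [hp, smul_eq_C_mul]⟩
  obtain ⟨φ, hφ⟩ := hlin
  have hφ0 : φ ≠ 0 := by
    rintro rfl
    apply hL0
    apply MvPolynomial.funext
    intro w
    rw [← hφ]; simp
  have hfr : Module.finrank ℂ (LinearMap.ker φ) = 2 := by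
    have h1 := LinearMap.finrank_range_add_finrank_ker φ
    rw [LinearMap.range_eq_top.2 (LinearMap.surjective hφ0)] at h1
    simp at h1
    omega
  let e := Module.finBasisOfFinrankEq ℂ (LinearMap.ker φ) hfr
  have hcoord : ∀ P ∈ A, ∃ x y : ℂ, P.rep = x • (e 0 : Fin 3 → ℂ) + y • (e 1 : Fin 3 → ℂ) := by
    intro P hP
    have hm : P.rep ∈ LinearMap.ker φ := by rw [LinearMap.mem_ker, hφ, hA P hP]
    have := e.sum_repr ⟨P.rep, hm⟩
    rw [Fin.sum_univ_two] at this
    exact ⟨_, _, (congrArg Subtype.val this).symm⟩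
  choose! x y hxy using hcoord
  obtain ⟨c, hc⟩ := Infinite.exists_notMem_finset (A.image fun P => x P / y P)
  have hli : LinearIndependent ℂ ![(e 0 : Fin 3 → ℂ), (e 1 : Fin 3 → ℂ)] := by
    have h := e.linearIndependent.map' (LinearMap.ker φ).subtype (Submodule.ker_subtype _)
    have h2 : ![(e 0 : Fin 3 → ℂ), (e 1 : Fin 3 → ℂ)] = (LinearMap.ker φ).subtype ∘ e := by
      funext i; fin_cases i <;> rfl
    rw [h2]; exact h
  refine ⟨e 0, e 1 + c • (e 0 : Fin 3 → ℂ), ?_, ?_⟩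
  · rw [LinearIndependent.pair_iff] at hli ⊢
    intro p q hpq
    have := hli (p + q * c) q (by rw [← hpq]; module)
    obtain ⟨h1, h2⟩ := this
    subst h2
    simpa using h1
  · intro P hP
    have hne : x P - c * y P ≠ 0 := by
      intro h
      by_cases hy : y P = 0
      · have hx : x P = 0 := by simpa [hy] using h
        apply P.rep_nonzero
        rw [hxy P hP, hx, hy]; simp
      · apply hc
        refine Finset.mem_image.2 ⟨P, hP, ?_⟩
        field_simp; linear_combination h
    refine ⟨x P - c * y P, y P / (x P - c * y P), hne, ?_⟩
    have h2 : (x P - c * y P) * (y P / (x P - c * y P)) = y P := by field_simp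
    rw [smul_add, smul_smul, h2, hxy P hP]
    module

lemma mainAux (s : ℕ) (hs : 2 ≤ s) (T : MvPolynomial (Fin 3) ℂ) (A : Finset (Pt 2))
    (hA : IsDecomp (2 * s - 2) A T) (A' : Finset (Pt 2)) (hA' : A' ⊆ A) (hcard : A'.card = s)
    (L : MvPolynomial (Fin 3) ℂ) (hL0 : L ≠ 0) (hL : L.IsHomogeneous 1)
    (hAL : ∀ P ∈ A', eval P.rep L = 0) :
    {B : Finset (Pt 2) | IsDecomp (2 * s - 2) B T ∧ B.card = A.card}.Infinite := by
  obtain ⟨u, v, huv, hP⟩ := line_coords L hL0 hL A' hAL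
  rw [LinearIndependent.pair_iff] at huv
  have hne : ∀ x : ℂ, u + x • v ≠ 0 := fun x h => by
    have := huv 1 x (by simpa using h)
    simp at this
  let pt : ℂ → Pt 2 := fun x => Projectivization.mk ℂ (u + x • v) (hne x)
  have hinj : Function.Injective pt := by
    intro x y hxy
    obtain ⟨c, hc⟩ := (Projectivization.mk_eq_mk_iff' ℂ _ _ _ _).1 hxy
    obtain ⟨h1, h2⟩ := huv (c - 1) (c * y - x) (by
      have : c • (u + y • v) - (u + x • v) = 0 := sub_eq_zero.2 hc
      rw [← this]; module)
    have : c = 1 := by linear_combination h1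
    subst this
    linear_combination -h2
  choose c hc0 hc using fun x => powRep_mk (2 * s - 2) (u + x • v) (hne x)
  have hsurj : ∀ P ∈ A', ∃ x, pt x = P := by
    intro P hP'
    obtain ⟨k, x, hk, h⟩ := hP P hP'
    refine ⟨x, ?_⟩
    rw [← P.mk_rep]
    refine (Projectivization.mk_eq_mk_iff' ℂ _ _ _ _).2 ⟨k⁻¹, ?_⟩
    rw [h, smul_smul, inv_mul_cancel₀ hk, one_smul]
  let t : Finset ℂ := A'.preimage pt hinj.injOn
  have ht : t.image pt = A' := by
    ext P
    simp only [Finset.mem_image, t, Finset.mem_preimage]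
    constructor
    · rintro ⟨x, hx, rfl⟩; exact hx
    · intro h
      obtain ⟨x, rfl⟩ := hsurj P h
      exact ⟨x, h, rfl⟩
  have htc : t.card = s := by
    rw [← hcard, ← ht, Finset.card_image_of_injective _ hinj]
  let E : Finset ℂ := (A \ A').preimage pt hinj.injOn
  have hEt : Disjoint E t := by
    rw [Finset.disjoint_left]
    intro x hx hxt
    simp only [E, t, Finset.mem_preimage, Finset.mem_sdiff] at hx hxt
    exact hx.2 hxt
  obtain ⟨a, ha⟩ := hA
  obtain ⟨S, hSinf, hS⟩ := pencil s hs t htc (fun x => a (pt x) * c x) E hEt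
  have hdisj : ∀ R ∈ S, Disjoint (A \ A') (R.image pt) := by
    intro R hR
    rw [Finset.disjoint_right]
    intro P hPR hPA
    obtain ⟨x, hx, rfl⟩ := Finset.mem_image.1 hPR
    exact Finset.disjoint_left.1 (hS R hR).2.1 hx (by simpa [E] using hPA)
  refine (hSinf.image (f := fun R => (A \ A') ∪ R.image pt) ?_).mono ?_
  · intro R hR R' hR' h
    simp only at h
    have h1 := congrArg (fun Z => Z \ (A \ A')) h
    simp only [Finset.union_sdiff_cancel_left (hdisj R hR),
      Finset.union_sdiff_cancel_left (hdisj R' hR')] at h1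
    exact Finset.image_injective hinj h1
  · rintro _ ⟨R, hR, rfl⟩
    obtain ⟨hRc, -, b, hb⟩ := hS R hR
    refine ⟨?_, ?_⟩
    · rw [isDecomp_iff, ha, ← Finset.sum_sdiff hA']
      refine add_mem (Submodule.sum_mem _ fun P hP => Submodule.smul_mem _ _
        (Submodule.subset_span ⟨P, by simp at hP ⊢; tauto, rfl⟩)) ?_
      have h1 : ∑ P ∈ A', a P • powRep (2 * s - 2) P =
          ∑ x ∈ t, (a (pt x) * c x) • (linForm u + C x * linForm v) ^ (2 * s - 2) := by
        rw [← ht, Finset.sum_image hinj.injOn]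
        refine Finset.sum_congr rfl fun x _ => ?_
        rw [hc x, smul_smul, linForm_add']
      rw [h1, transfer _ t R _ b hb]
      refine Submodule.sum_mem _ fun x hx => Submodule.smul_mem _ _ ?_
      have h2 : (linForm u + C x * linForm v) ^ (2 * s - 2) =
          (c x)⁻¹ • powRep (2 * s - 2) (pt x) := by
        rw [hc x, smul_smul, inv_mul_cancel₀ (hc0 x), one_smul, linForm_add']
      rw [h2]
      refine Submodule.smul_mem _ _ (Submodule.subset_span ⟨pt x, ?_, rfl⟩)
      simp only [Finset.coe_union, Set.mem_union, Finset.mem_coe]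
      exact Or.inr (Finset.mem_image_of_mem _ hx)
    · rw [Finset.card_union_of_disjoint (hdisj R hR), Finset.card_image_of_injective _ hinj, hRc,
        ← hcard, Finset.card_sdiff_add_card_eq_card hA']

/-- If a decomposition `A` of a ternary form `T` of degree `8+2n`, of length
`r ≤ 11+3n`, contains at least `5+n` collinear points, then `T` admits infinitely many
decompositions of length `r`. -/
theorem stmt3 (n : ℕ) (T : MvPolynomial (Fin 3) ℂ) (hT0 : T ≠ 0)
    (hThom : T.IsHomogeneous (8 + 2 * n))
    (A : Finset (Pt 2)) (hA : IsDecomp (8 + 2 * n) A T)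
    (hr : A.card ≤ 11 + 3 * n)
    (hline : ∃ A' ⊆ A, 5 + n ≤ A'.card ∧
      ∃ L : MvPolynomial (Fin 3) ℂ, L ≠ 0 ∧ L.IsHomogeneous 1 ∧
        ∀ P ∈ A', eval (Projectivization.rep P) L = 0) :
    {B : Finset (Pt 2) | IsDecomp (8 + 2 * n) B T ∧ B.card = A.card}.Infinite := by
  obtain ⟨A', hA', hc, L, hL0, hL, hAL⟩ := hline
  obtain ⟨A'', hA'', hc'⟩ := Finset.exists_subset_card_eq hc
  have hd : 8 + 2 * n = 2 * (5 + n) - 2 := by omega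
  rw [hd] at hA ⊢
  exact mainAux (5 + n) (by omega) T A hA A'' (hA''.trans hA') hc' L hL0 hL
    fun P hP => hAL P (hA'' hP)

end
end

section
/- Let T be a ternary form of degree d and let A ⊂ ℙ^2 be a decomposition of T of length r = ℓ(A). Suppose A is contained in a plane curve C (the zero locus in ℙ^2 of a nonzero homogeneous polynomial), and the linear span of ν_d(C) ⊂ ℙ(Sym^d(ℂ^3)) has projective dimension k with k < 2r − 1. Then T admits infinitely many pairwise distinct decompositions of length r contained in C (a positive-dimensional family {A_t} of decompositions of T with A_0 = A). -/
open MvPolynomial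
open scoped Classical

noncomputable section

lemma height_point {σ : Type} [Fintype σ] (p : σ → ℂ) :
    ((Fintype.card σ : ℕ) : ℕ∞) ≤ (vanishingIdeal ℂ ({p} : Set (σ → ℂ))).height := by
  have hd : ringKrullDim (MvPolynomial σ ℂ) = (Fintype.card σ : ℕ) := by
    rw [MvPolynomial.ringKrullDim_of_isNoetherianRing]; simp
  have : FiniteRingKrullDim (MvPolynomial σ ℂ) := by
    rw [finiteRingKrullDim_iff_ne_bot_and_top, hd]
    refine ⟨by simp, ?_⟩
    exact fun h => by
      have : ((Fintype.card σ : ℕ∞) : WithBot ℕ∞) = ((⊤ : ℕ∞) : WithBot ℕ∞) := h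
      exact ENat.natCast_ne_top _ (WithBot.coe_injective this)
  obtain ⟨M, hM, hh⟩ := Ideal.exists_isMaximal_height (R := MvPolynomial σ ℂ)
  obtain ⟨x, rfl⟩ := isMaximal_iff_eq_vanishingIdeal_singleton.1 hM
  let e : MvPolynomial σ ℂ ≃ₐ[ℂ] MvPolynomial σ ℂ :=
    AlgEquiv.ofAlgHom (aeval (fun i => X i + C (p i - x i))) (aeval (fun i => X i - C (p i - x i)))
      (by ext i : 1; simp) (by ext i : 1; simp)
  have he : vanishingIdeal ℂ ({p} : Set (σ → ℂ)) =
      (vanishingIdeal ℂ ({x} : Set (σ → ℂ))).comap e.toRingEquiv := by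
    ext f
    rw [Ideal.mem_comap, mem_vanishingIdeal_singleton_iff, mem_vanishingIdeal_singleton_iff]
    have : (aeval x : MvPolynomial σ ℂ →ₐ[ℂ] ℂ).comp e.toAlgHom = aeval p := by
      ext i; simp [e]
    rw [← this]; rfl
  rw [he, RingEquiv.height_comap]
  rw [hd] at hh
  have : (((Fintype.card σ : ℕ) : ℕ∞) : WithBot ℕ∞) = ((vanishingIdeal ℂ ({x} : Set (σ → ℂ))).height : WithBot ℕ∞) := by
    rw [hh]; rfl
  exact (WithBot.coe_injective this).le

lemma infinite_zeros {σ ι : Type} [Fintype σ] [Fintype ι] (hc : Fintype.card ι < Fintype.card σ)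
    (f : ι → MvPolynomial σ ℂ) (h : MvPolynomial σ ℂ) (p : σ → ℂ)
    (hf : ∀ i, eval p (f i) = 0) (hh : eval p h ≠ 0) :
    {v : σ → ℂ | (∀ i, eval v (f i) = 0) ∧ eval v h ≠ 0}.Infinite := by
  intro hfin
  have hle : Ideal.span (Set.range f) ≤ vanishingIdeal ℂ ({p} : Set (σ → ℂ)) := by
    rw [Ideal.span_le]; rintro _ ⟨i, rfl⟩
    exact (mem_vanishingIdeal_singleton_iff _ _).2 (hf i)
  obtain ⟨q, hq, hqp⟩ := Ideal.exists_minimalPrimes_le hle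
  have hqP : q.IsPrime := hq.1.1
  have h1 := Ideal.height_le_card_of_mem_minimalPrimes_span (Set.finite_range f) hq
  have h2 : (Set.range f).ncard ≤ Fintype.card ι := by
    rw [← Set.image_univ]
    exact (Set.ncard_image_le Set.finite_univ).trans (by simp [Set.ncard_univ])
  have hmax : ∀ x : σ → ℂ, ∃ g : MvPolynomial σ ℂ, eval x g = 0 ∧ g ∉ q := by
    intro x
    by_contra! hcon
    have : vanishingIdeal ℂ ({x} : Set (σ → ℂ)) ≤ q := fun g hg =>
      hcon g ((mem_vanishingIdeal_singleton_iff _ _).1 hg)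
    have h3 := (height_point x).trans ((Ideal.height_mono this).trans h1)
    have h4 : Fintype.card σ ≤ (Set.range f).ncard := by exact_mod_cast h3
    omega
  choose g hg hgq using hmax
  have hmem : h * ∏ x ∈ hfin.toFinset, g x ∈ q := by
    rw [← IsPrime.vanishingIdeal_zeroLocus (K := ℂ) q]
    intro v hv
    change eval v _ = 0
    rw [map_mul, map_prod]
    by_cases hv0 : eval v h = 0
    · simp [hv0]
    · rw [Finset.prod_eq_zero (i := v), mul_zero]
      · rw [Set.Finite.mem_toFinset]
        exact ⟨fun i => hv _ (hq.1.2 (Ideal.subset_span ⟨i, rfl⟩)), hv0⟩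
      · exact hg v
  rcases hqP.mem_or_mem hmem with h5 | h5
  · exact hh ((mem_vanishingIdeal_singleton_iff _ _).1 (hqp h5))
  · obtain ⟨x, -, hx⟩ := (hqP.prod_mem_iff).1 h5
    exact hgq x hx

lemma exists_poly_functional (d : ℕ) : ∀ φ : MvPolynomial (Fin 3) ℂ →ₗ[ℂ] ℂ,
    ∃ F : MvPolynomial (Fin 3) ℂ, ∀ v : Fin 3 → ℂ,
      eval v F = φ ((∑ i, C (v i) * X i) ^ d) := by
  induction d with
  | zero => intro φ; exact ⟨C (φ 1), by simp⟩
  | succ d ih =>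
    intro φ
    choose F hF using fun i : Fin 3 => ih (φ ∘ₗ LinearMap.mulLeft ℂ (X i))
    refine ⟨∑ i, X i * F i, fun v => ?_⟩
    simp only [map_sum, map_mul, eval_X, hF]
    rw [pow_succ', Finset.sum_mul, map_sum]
    refine Finset.sum_congr rfl fun i _ => ?_
    rw [mul_assoc, ← smul_eq_C_mul, map_smul]
    simp

lemma eval_smul_homog {G : MvPolynomial (Fin 3) ℂ} {e : ℕ} (hG : G.IsHomogeneous e)
    (c : ℂ) (v : Fin 3 → ℂ) : eval (c • v) G = c ^ e * eval v G := by
  rw [eval_eq, eval_eq, Finset.mul_sum]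
  refine Finset.sum_congr rfl fun s hs => ?_
  have hdeg : ∑ i ∈ s.support, s i = e := by
    have := hG (mem_support_iff.1 hs)
    rw [Finsupp.weight_apply] at this
    simpa [Finsupp.sum] using this
  simp only [Pi.smul_apply, smul_eq_mul, mul_pow, Finset.prod_mul_distrib,
    Finset.prod_pow_eq_pow_sum, hdeg]
  ring

lemma linForm_smul (c : ℂ) (v : Fin 3 → ℂ) :
    linForm (m := 2) (c • v) = c • linForm (m := 2) v := by
  simp only [linForm, Finset.smul_sum, smul_eq_C_mul, Pi.smul_apply, smul_eq_mul, map_mul,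
    mul_assoc]

lemma curve_infinite {G : MvPolynomial (Fin 3) ℂ} {e : ℕ} (hG : G.IsHomogeneous e)
    (P₀ : Pt 2) (hP : eval P₀.rep G = 0) : {P : Pt 2 | eval P.rep G = 0}.Infinite := by
  obtain ⟨i, hi⟩ : ∃ i, P₀.rep i ≠ 0 := by
    by_contra! h
    exact P₀.rep_nonzero (funext h)
  have hS := infinite_zeros (σ := Fin 3) (ι := Fin 2) (by simp)
    ![G, X i - C (P₀.rep i)] 1 P₀.rep
    (by intro j; fin_cases j <;> simp [hP]) (by simp)
  let f : (Fin 3 → ℂ) → Pt 2 := fun v => if h : v ≠ 0 then Projectivization.mk ℂ v h else P₀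
  have hprop : ∀ v ∈ {v : Fin 3 → ℂ | (∀ j, eval v (![G, X i - C (P₀.rep i)] j) = 0) ∧
      eval v (1 : MvPolynomial (Fin 3) ℂ) ≠ 0},
      eval v G = 0 ∧ v i = P₀.rep i ∧ v ≠ 0 := by
    intro v hv
    have h0 := hv.1 0
    have h1 := hv.1 1
    simp [sub_eq_zero] at h0 h1
    refine ⟨h0, h1, ?_⟩
    rintro rfl
    exact hi h1.symm
  refine (hS.image (f := f) ?_).mono ?_
  · intro v hv w hw hvw
    obtain ⟨-, hv1, hv0⟩ := hprop v hv
    obtain ⟨-, hw1, hw0⟩ := hprop w hw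
    simp only [f, dif_pos hv0, dif_pos hw0] at hvw
    rw [Projectivization.mk_eq_mk_iff'] at hvw
    obtain ⟨a, ha⟩ := hvw
    have h2 := congrFun ha i
    rw [Pi.smul_apply, hv1, hw1, smul_eq_mul] at h2
    have : a = 1 := mul_right_cancel₀ hi (by rw [h2, one_mul])
    rw [← ha, this, one_smul]
  · rintro _ ⟨v, hv, rfl⟩
    obtain ⟨hv2, -, hv0⟩ := hprop v hv
    simp only [f, dif_pos hv0, Set.mem_ofPred_eq]
    obtain ⟨a, ha⟩ := Projectivization.exists_smul_eq_mk_rep ℂ v hv0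
    rw [← ha, Units.smul_def, eval_smul_homog hG, hv2, mul_zero]

/-- The set of decompositions of interest. -/
def GoodSet (d r : ℕ) (T G : MvPolynomial (Fin 3) ℂ) : Set (Finset (Pt 2)) :=
  {B : Finset (Pt 2) | IsDecomp d B T ∧ B.card = r ∧
      ∀ P ∈ B, eval (Projectivization.rep P) G = 0}

lemma good_infinite_of_replace {d r : ℕ} {T G : MvPolynomial (Fin 3) ℂ} {e : ℕ}
    (hG : G.IsHomogeneous e) {B : Finset (Pt 2)} (hB : B ∈ GoodSet d r T G) {Q : Pt 2}
    (hQ : Q ∈ B) (h : ∀ P, P ∉ B → IsDecomp d (insert P (B.erase Q)) T) :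
    (GoodSet d r T G).Infinite := by
  have hinf := (curve_infinite hG Q (hB.2.2 Q hQ)).sdiff B.finite_toSet
  refine (hinf.image (f := fun P => insert P (B.erase Q)) ?_).mono ?_
  · intro P hP P' hP' hPP
    have h1 : P ∈ insert P' (B.erase Q) := by
      rw [← show insert P (B.erase Q) = insert P' (B.erase Q) from hPP]
      exact Finset.mem_insert_self _ _
    rcases Finset.mem_insert.1 h1 with h1 | h1
    · exact h1
    · exact absurd (Finset.mem_of_mem_erase h1) hP.2
  · rintro _ ⟨P, hP, rfl⟩
    have hPB : P ∉ B := hP.2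
    refine ⟨h P hPB, ?_, ?_⟩
    · rw [Finset.card_insert_of_notMem (fun h => hPB (Finset.mem_of_mem_erase h)),
        Finset.card_erase_add_one hQ, hB.2.1]
    · intro R hR
      rcases Finset.mem_insert.1 hR with rfl | hR
      · exact hP.1
      · exact hB.2.2 R (Finset.mem_of_mem_erase hR)

lemma good_infinite_of_redundant {d r : ℕ} {T G : MvPolynomial (Fin 3) ℂ} {e : ℕ}
    (hG : G.IsHomogeneous e) {B : Finset (Pt 2)} (hB : B ∈ GoodSet d r T G) {Q : Pt 2}
    (hQ : Q ∈ B) (a : Pt 2 → ℂ) (ha : T = ∑ P ∈ B, a P • powRep d P) (ha0 : a Q = 0) :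
    (GoodSet d r T G).Infinite := by
  refine good_infinite_of_replace hG hB hQ fun P hP => ⟨fun R => if R = P then 0 else a R, ?_⟩
  rw [Finset.sum_insert (fun h => hP (Finset.mem_of_mem_erase h)), ha,
    ← Finset.add_sum_erase _ _ hQ, ha0]
  simp only [if_true, zero_smul, zero_add]
  refine Finset.sum_congr rfl fun R hR => ?_
  rw [if_neg]
  rintro rfl
  exact hP (Finset.mem_of_mem_erase hR)

lemma coeff_unique {d r : ℕ} {T G : MvPolynomial (Fin 3) ℂ} {e : ℕ}
    (hG : G.IsHomogeneous e) (hfin : (GoodSet d r T G).Finite)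
    {B : Finset (Pt 2)} (hB : B ∈ GoodSet d r T G) {Q : Pt 2}
    (hQ : Q ∈ B) (a b : Pt 2 → ℂ) (ha : T = ∑ P ∈ B, a P • powRep d P)
    (hb : T = ∑ P ∈ B, b P • powRep d P) : a Q = b Q := by
  by_contra hne
  have hne' : a Q - b Q ≠ 0 := sub_ne_zero.2 hne
  refine good_infinite_of_redundant hG hB hQ
    (fun P => (-b Q / (a Q - b Q)) * a P + (a Q / (a Q - b Q)) * b P) ?_ ?_ hfin
  · simp only [add_smul, mul_smul, Finset.sum_add_distrib, ← Finset.smul_sum, ← ha, ← hb]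
    rw [← add_smul]
    have : -b Q / (a Q - b Q) + a Q / (a Q - b Q) = 1 := by field_simp; ring
    rw [this, one_smul]
  · field_simp; ring

lemma exists_sep (A : Finset (Pt 2)) (p : A × Fin 3 → ℂ) (c : A → ℂ)
    (hc : ∀ P, c P ≠ 0) (hp : ∀ x, p x = c x.1 * x.1.1.rep x.2) (P Q : A) :
    ∃ m : MvPolynomial (A × Fin 3) ℂ, eval p m ≠ 0 ∧ ∀ v, eval v m ≠ 0 →
      (fun i => v (P, i)) ≠ 0 ∧
      (P ≠ Q → ∀ u : ℂ, u • (fun i => v (Q, i)) ≠ (fun i => v (P, i))) := by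
  by_cases hPQ : P = Q
  · obtain ⟨i, hi⟩ : ∃ i, P.1.rep i ≠ 0 := by
      by_contra! h
      exact P.1.rep_nonzero (funext h)
    refine ⟨X (P, i), by simp [hp, hc, hi], fun v hv => ⟨fun h => hv ?_, fun h => absurd hPQ h⟩⟩
    simpa using congrFun h i
  · obtain ⟨i, j, hij⟩ : ∃ i j, P.1.rep i * Q.1.rep j - P.1.rep j * Q.1.rep i ≠ 0 := by
      by_contra! h
      obtain ⟨j, hj⟩ : ∃ i, Q.1.rep i ≠ 0 := by
        by_contra! h
        exact Q.1.rep_nonzero (funext h)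
      apply hPQ
      apply Subtype.ext
      rw [← P.1.mk_rep, ← Q.1.mk_rep, Projectivization.mk_eq_mk_iff']
      refine ⟨P.1.rep j / Q.1.rep j, funext fun i => ?_⟩
      have := h i j
      simp only [Pi.smul_apply, smul_eq_mul]
      field_simp
      linear_combination -this
    refine ⟨X (P, i) * X (Q, j) - X (P, j) * X (Q, i), ?_, ?_⟩
    · simp only [map_sub, map_mul, eval_X, hp]
      have : c P * P.1.rep i * (c Q * Q.1.rep j) - c P * P.1.rep j * (c Q * Q.1.rep i) =
        c P * c Q * (P.1.rep i * Q.1.rep j - P.1.rep j * Q.1.rep i) := by ring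
      rw [this]
      exact mul_ne_zero (mul_ne_zero (hc P) (hc Q)) hij
    · intro v hv
      simp only [map_sub, map_mul, eval_X] at hv
      refine ⟨fun h => hv ?_, fun _ u hu => hv ?_⟩
      · have h1 := congrFun h i
        have h2 := congrFun h j
        simp only [Pi.zero_apply] at h1 h2
        rw [h1, h2]; ring
      · have h1 := congrFun hu i
        have h2 := congrFun hu j
        simp only [Pi.smul_apply, smul_eq_mul] at h1 h2
        rw [← h1, ← h2]; ring

lemma good_of_vectors {d : ℕ} {T G : MvPolynomial (Fin 3) ℂ} {e : ℕ}
    (hG : G.IsHomogeneous e) (A : Finset (Pt 2)) (v : A → Fin 3 → ℂ)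
    (hv0 : ∀ P, v P ≠ 0) (hinj : ∀ P Q, P ≠ Q → ∀ u : ℂ, u • v Q ≠ v P)
    (hvG : ∀ P, eval (v P) G = 0) (hT : T = ∑ P, linForm (m := 2) (v P) ^ d) :
    ∃ B ∈ GoodSet d A.card T G, ∃ a : Pt 2 → ℂ, T = ∑ P ∈ B, a P • powRep d P ∧
      ∀ P, ∃ Q ∈ B, ∃ c : ℂ, c ^ d = a Q ∧ c • Q.rep = v P := by
  let pt : A → Pt 2 := fun P => Projectivization.mk ℂ (v P) (hv0 P)
  have hpt : Function.Injective pt := by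
    intro P Q h
    by_contra hne
    obtain ⟨u, hu⟩ := (Projectivization.mk_eq_mk_iff' ℂ _ _ (hv0 P) (hv0 Q)).1 h
    exact hinj P Q hne u hu
  have hc : ∀ P, ∃ c : ℂ, c • (pt P).rep = v P := by
    intro P
    obtain ⟨a, ha⟩ := Projectivization.exists_smul_eq_mk_rep ℂ (v P) (hv0 P)
    refine ⟨((a⁻¹ : ℂˣ) : ℂ), ?_⟩
    rw [← Units.smul_def, inv_smul_eq_iff]
    exact ha.symm
  choose c hc using hc
  have hTa : T = ∑ P ∈ Finset.univ.image pt,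
      Function.extend pt (fun P => c P ^ d) 0 P • powRep d P := by
    rw [Finset.sum_image hpt.injOn, hT]
    refine Finset.sum_congr rfl fun P _ => ?_
    rw [hpt.extend_apply, powRep, ← hc P, linForm_smul, smul_pow]
  refine ⟨Finset.univ.image pt, ⟨⟨_, hTa⟩, ?_, ?_⟩, _, hTa, ?_⟩
  · rw [Finset.card_image_of_injective _ hpt]; simp
  · intro R hR
    obtain ⟨P, -, rfl⟩ := Finset.mem_image.1 hR
    obtain ⟨a, ha⟩ := Projectivization.exists_smul_eq_mk_rep ℂ (v P) (hv0 P)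
    rw [← ha, Units.smul_def, eval_smul_homog hG, hvG, mul_zero]
  · intro P
    exact ⟨pt P, Finset.mem_image_of_mem _ (Finset.mem_univ _), c P,
      by rw [hpt.extend_apply], hc P⟩

lemma finite_fiber {d : ℕ} (hd : 0 < d) (A B : Finset (Pt 2)) (a : Pt 2 → ℂ) :
    {v : A × Fin 3 → ℂ | ∀ P, ∃ Q ∈ B, ∃ c : ℂ, c ^ d = a Q ∧
      c • Q.rep = fun i => v (P, i)}.Finite := by
  let F : Set (Fin 3 → ℂ) := ⋃ Q ∈ B, (fun c : ℂ => c • Q.rep) '' {c | c ^ d = a Q}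
  have hF : F.Finite := by
    refine B.finite_toSet.biUnion fun Q _ => Set.Finite.image _ ?_
    refine (Polynomial.nthRoots d (a Q)).toFinset.finite_toSet.subset fun c hc => ?_
    simpa [Polynomial.mem_nthRoots hd] using hc
  refine ((Set.Finite.pi' (fun _ : A => hF)).image
    (fun w : A → Fin 3 → ℂ => fun x : A × Fin 3 => w x.1 x.2)).subset ?_
  intro v hv
  refine ⟨fun P i => v (P, i), fun P => ?_, rfl⟩
  obtain ⟨Q, hQ, c, hc, hcv⟩ := hv P
  simp only [F, Set.mem_iUnion]
  exact ⟨Q, hQ, c, hc, hcv⟩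

lemma exists_functionals (W : Submodule ℂ (MvPolynomial (Fin 3) ℂ)) (k : ℕ)
    (hW : Module.finrank ℂ W = k + 1) :
    ∃ φ : Fin (k + 1) → MvPolynomial (Fin 3) ℂ →ₗ[ℂ] ℂ,
      ∀ w ∈ W, (∀ j, φ j w = 0) → w = 0 := by
  have : Module.Finite ℂ W := Module.finite_of_finrank_pos (by omega)
  let b := Module.finBasisOfFinrankEq ℂ W hW
  obtain ⟨g, hg⟩ := LinearMap.exists_leftInverse_of_injective W.subtype W.ker_subtype
  refine ⟨fun j => b.coord j ∘ₗ g, fun w hw h => ?_⟩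
  have h1 : g w = ⟨w, hw⟩ := LinearMap.congr_fun hg ⟨w, hw⟩
  have h2 : (⟨w, hw⟩ : W) = 0 := by
    rw [← h1]
    exact (b.forall_coord_eq_zero_iff).1 h
  exact congrArg Subtype.val h2

/-- If a decomposition `A` of a ternary form `T` of degree `d` is contained in
a plane curve `C = {G = 0}` whose Veronese image `ν_d(C)` spans a projective space of
dimension `k < 2r - 1`, then `T` admits infinitely many decompositions of length `r`
contained in `C`. -/
theorem stmt6 (d : ℕ) (T : MvPolynomial (Fin 3) ℂ) (hT0 : T ≠ 0)
    (hThom : T.IsHomogeneous d)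
    (A : Finset (Pt 2)) (hA : IsDecomp d A T)
    (G : MvPolynomial (Fin 3) ℂ) (e : ℕ) (hG0 : G ≠ 0) (hGhom : G.IsHomogeneous e)
    (hAC : ∀ P ∈ A, eval (Projectivization.rep P) G = 0)
    (k : ℕ)
    (hspan : Module.finrank ℂ (Submodule.span ℂ
      {q : MvPolynomial (Fin 3) ℂ | ∃ v : Fin 3 → ℂ, v ≠ 0 ∧ eval v G = 0 ∧
        q = linForm v ^ d}) = k + 1)
    (hk : k + 1 < 2 * A.card) :
    {B : Finset (Pt 2) | IsDecomp d B T ∧ B.card = A.card ∧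
      ∀ P ∈ B, eval (Projectivization.rep P) G = 0}.Infinite := by
  change (GoodSet d A.card T G).Infinite
  intro hfin
  have hAgood : A ∈ GoodSet d A.card T G := ⟨hA, rfl, hAC⟩
  obtain ⟨Q₀, hQ₀⟩ : A.Nonempty := Finset.card_pos.1 (by omega)
  obtain ⟨a, ha⟩ := hA
  -- the degree is positive
  have hd : 0 < d := by
    rcases Nat.eq_zero_or_pos d with rfl | hd
    · exfalso
      refine good_infinite_of_replace hGhom hAgood hQ₀ (fun P hP => ?_) hfin
      refine ⟨fun R => if R = P then ∑ S ∈ A, a S else 0, ?_⟩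
      have hz : ∑ R ∈ A.erase Q₀, (if R = P then ∑ S ∈ A, a S else 0) • powRep 0 R = 0 := by
        refine Finset.sum_eq_zero fun R hR => ?_
        rw [if_neg, zero_smul]
        rintro rfl
        exact hP (Finset.mem_of_mem_erase hR)
      rw [Finset.sum_insert (fun h => hP (Finset.mem_of_mem_erase h)), hz, ha]
      simp [powRep, Finset.sum_smul]
    · exact hd
  have ha0 : ∀ P ∈ A, a P ≠ 0 := fun P hP h0 =>
    good_infinite_of_redundant hGhom hAgood hP a ha h0 hfin
  choose c hc using fun P : A => IsAlgClosed.exists_pow_nat_eq (a P.1) hd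
  have hc0 : ∀ P, c P ≠ 0 := by
    intro P h
    apply ha0 P.1 P.2
    rw [← hc P, h, zero_pow hd.ne']
  set W := Submodule.span ℂ
      {q : MvPolynomial (Fin 3) ℂ | ∃ v : Fin 3 → ℂ, v ≠ 0 ∧ eval v G = 0 ∧
        q = linForm v ^ d} with hW
  obtain ⟨φ, hφ⟩ := exists_functionals W k hspan
  choose F hF using fun j => exists_poly_functional d (φ j)
  have hF' : ∀ j (v : Fin 3 → ℂ), eval v (F j) = φ j (linForm (m := 2) v ^ d) := hF
  let p : A × Fin 3 → ℂ := fun x => c x.1 * x.1.1.rep x.2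
  have hpP : ∀ P : A, (fun i => p (P, i)) = c P • P.1.rep := fun P => rfl
  choose m hm hm' using fun P Q : A => exists_sep A p c hc0 (fun _ => rfl) P Q
  let f : A ⊕ Fin (k + 1) → MvPolynomial (A × Fin 3) ℂ :=
    Sum.elim (fun P => rename (fun i => (P, i)) G)
      (fun j => (∑ P : A, rename (fun i => (P, i)) (F j)) - C (φ j T))
  have hfl : ∀ (v : A × Fin 3 → ℂ) P, eval v (f (Sum.inl P)) = eval (fun i => v (P, i)) G := by
    intro v P
    simp only [f, Sum.elim_inl, eval_rename]
    rfl
  have hfr : ∀ (v : A × Fin 3 → ℂ) j, eval v (f (Sum.inr j)) =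
      φ j ((∑ P : A, linForm (m := 2) (fun i => v (P, i)) ^ d) - T) := by
    intro v j
    simp only [f, Sum.elim_inr, eval_rename, map_sub, map_sum, eval_C]
    congr 1
    refine Finset.sum_congr rfl fun P _ => ?_
    exact hF' j _
  have hTp : T = ∑ P : A, linForm (m := 2) (fun i => p (P, i)) ^ d := by
    rw [ha, ← Finset.sum_coe_sort]
    refine Finset.sum_congr rfl fun P _ => ?_
    rw [hpP, linForm_smul, smul_pow, hc, powRep]
  have hTW : T ∈ W := by
    rw [ha]
    refine Submodule.sum_mem _ fun P hP => Submodule.smul_mem _ _ (Submodule.subset_span ?_)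
    exact ⟨P.rep, P.rep_nonzero, hAC P hP, rfl⟩
  have hinf := infinite_zeros (σ := A × Fin 3) (ι := A ⊕ Fin (k + 1))
    (by simp; omega) f (∏ P : A, ∏ Q : A, m P Q) p
    (by
      rintro (P | j)
      · rw [hfl, hpP, eval_smul_homog hGhom, hAC P.1 P.2, mul_zero]
      · rw [hfr, ← hTp, sub_self, map_zero])
    (by
      simp only [map_prod]
      exact Finset.prod_ne_zero_iff.2 fun P _ => Finset.prod_ne_zero_iff.2 fun Q _ => hm P Q)
  choose! b hb using fun B (hB : B ∈ GoodSet d A.card T G) => hB.1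
  refine hinf ((hfin.biUnion fun B _ => finite_fiber hd A B (b B)).subset ?_)
  rintro v ⟨hv1, hv2⟩
  simp only [map_prod] at hv2
  have hv3 : ∀ P Q, eval v (m P Q) ≠ 0 := fun P Q =>
    Finset.prod_ne_zero_iff.1 (Finset.prod_ne_zero_iff.1 hv2 P (Finset.mem_univ _)) Q
      (Finset.mem_univ _)
  have hvG : ∀ P : A, eval (fun i => v (P, i)) G = 0 := fun P => by
    rw [← hfl]; exact hv1 _
  have hv0 : ∀ P : A, (fun i => v (P, i)) ≠ 0 := fun P => (hm' P P v (hv3 P P)).1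
  have hvT : T = ∑ P : A, linForm (m := 2) (fun i => v (P, i)) ^ d := by
    symm
    rw [← sub_eq_zero]
    refine hφ _ (Submodule.sub_mem _ (Submodule.sum_mem _ fun P _ =>
      Submodule.subset_span ⟨_, hv0 P, hvG P, rfl⟩) hTW) fun j => ?_
    rw [← hfr]; exact hv1 _
  obtain ⟨B, hB, a', ha', hfib⟩ := good_of_vectors hGhom A (fun P i => v (P, i)) hv0
    (fun P Q h => (hm' P Q v (hv3 P Q)).2 h) hvG hvT
  simp only [Set.mem_iUnion]
  refine ⟨B, hB, fun P => ?_⟩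
  obtain ⟨Q, hQ, c', hc', hcv⟩ := hfib P
  refine ⟨Q, hQ, c', ?_, hcv⟩
  rw [hc']
  exact coeff_unique hGhom hfin hB hQ _ _ ha' (hb B hB)

end
end

section
/- (Reshaped Kruskal criterion.) Let T be a form of degree d in m+1 variables and let A be a non-redundant decomposition of T with ℓ(A) = r. Let d = a+b+c be a partition of d with a, b, c ≥ 1, and let k_a, k_b, k_c denote the a-th, b-th and c-th Kruskal ranks of A. If r ≤ (k_a + k_b + k_c − 2)/2, then T has rank r and is identifiable. -/
open MvPolynomial
open scoped Classical

noncomputable section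

open Module in
lemma union_lemma {ι κ : Type} [Finite ι] [Finite κ] (V : Submodule ℂ (ι → ℂ))
    (hV : ∀ P, ∃ v ∈ V, v P ≠ 0) (N : κ → Submodule ℂ (ι → ℂ))
    (h : ∀ v ∈ V, (∀ P, v P ≠ 0) → ∃ j, v ∈ N j) : ∃ j, V ≤ N j := by
  let M : ι ⊕ κ → Submodule ℂ V := fun s => match s with
    | Sum.inl P => ((LinearMap.proj P : (ι → ℂ) →ₗ[ℂ] ℂ).ker).comap V.subtype
    | Sum.inr j => (N j).comap V.subtype
  have hcov : ⋃ i, (M i : Set V) = Set.univ := by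
    rw [Set.eq_univ_iff_forall]
    rintro ⟨v, hv⟩
    rw [Set.mem_iUnion]
    by_cases hn : ∀ P, v P ≠ 0
    · obtain ⟨j, hj⟩ := h v hv hn
      exact ⟨Sum.inr j, by simpa [M] using hj⟩
    · push Not at hn
      obtain ⟨P, hP⟩ := hn
      exact ⟨Sum.inl P, by simpa [M] using hP⟩
  obtain ⟨i, hi⟩ := Subspace.exists_eq_top_of_iUnion_eq_univ hcov
  rcases i with P | j
  · exfalso
    obtain ⟨v, hv, hvP⟩ := hV P
    have : (⟨v, hv⟩ : V) ∈ M (Sum.inl P) := by rw [hi]; trivial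
    exact hvP (by simpa [M] using this)
  · refine ⟨j, fun v hv => ?_⟩
    have : (⟨v, hv⟩ : V) ∈ M (Sum.inr j) := by rw [hi]; trivial
    simpa [M] using this

lemma exists_nowhere_zero {ι : Type} [Finite ι] (V : Submodule ℂ (ι → ℂ))
    (hV : ∀ P, ∃ v ∈ V, v P ≠ 0) : ∃ v ∈ V, ∀ P, v P ≠ 0 := by
  by_contra hcon
  push Not at hcon
  obtain ⟨j, hj⟩ := union_lemma (κ := Empty) V hV (fun e => e.elim)
    (fun v hv h => by obtain ⟨P, hP⟩ := hcon v hv; exact absurd hP (h P))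
  exact j.elim

/-- indicator function -/
def indi {ι : Type} (Y : Finset ι) : ι → ℂ := fun P => if P ∈ Y then 1 else 0

/-- multiplication by `e`. -/
def mulL {ι : Type} (e : ι → ℂ) : (ι → ℂ) →ₗ[ℂ] (ι → ℂ) := LinearMap.mulLeft ℂ e

@[simp] lemma mulL_apply {ι : Type} (e f : ι → ℂ) : mulL e f = e * f := rfl

lemma mulL_inj {ι : Type} (e : ι → ℂ) (he : ∀ P, e P ≠ 0) : Function.Injective (mulL e) := by
  intro f g h
  funext P
  have := congrFun h P
  simpa [he P] using this

lemma finrank_mulL {ι : Type} [Finite ι] (e : ι → ℂ) (he : ∀ P, e P ≠ 0)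
    (V : Submodule ℂ (ι → ℂ)) :
    Module.finrank ℂ (V.map (mulL e)) = Module.finrank ℂ V :=
  (Submodule.equivMapOfInjective _ (mulL_inj e he) V).finrank_eq.symm

lemma stable_indicator {ι : Type} [Fintype ι] (V : Submodule ℂ (ι → ℂ)) (u : ι → ℂ)
    (hu : ∀ v ∈ V, u * v ∈ V) (p q : ι) (hpq : u p ≠ u q) :
    ∃ Y : Finset ι, (Y ≠ ∅ ∧ Y ≠ Finset.univ) ∧ ∀ v ∈ V, indi Y * v ∈ V := by
  refine ⟨Finset.univ.filter (fun x => u x = u p), ⟨?_, ?_⟩, ?_⟩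
  · intro h
    have : p ∈ Finset.univ.filter (fun x => u x = u p) := by simp
    rw [h] at this; simp at this
  · intro h
    have : q ∈ Finset.univ.filter (fun x => u x = u p) := by rw [h]; simp
    simp at this; exact hpq this.symm
  · have key : ∀ s : Finset ℂ, ∀ v ∈ V, (fun x => ∏ t ∈ s, (u x - t)) * v ∈ V := by
      intro s
      induction s using Finset.induction_on with
      | empty =>
        intro v hv
        convert hv using 1
        funext x; simp
      | insert t s ht ih =>
        intro v hv
        have h1 := V.sub_mem (hu _ (ih v hv)) (V.smul_mem t (ih v hv))
        convert h1 using 1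
        funext x
        simp [Finset.prod_insert ht]
        ring
    intro v hv
    set s := (Finset.univ.image u).erase (u p)
    have h0 : ∏ t ∈ s, (u p - t) ≠ 0 := by
      rw [Finset.prod_ne_zero_iff]
      intro t ht
      have := Finset.ne_of_mem_erase ht
      exact sub_ne_zero.mpr this.symm
    have h1 := V.smul_mem (∏ t ∈ s, (u p - t))⁻¹ (key s v hv)
    convert h1 using 1
    funext x
    by_cases hx : u x = u p
    · simp [indi, hx, h0]
    · have : ∏ t ∈ s, (u x - t) = 0 := by
        apply Finset.prod_eq_zero (i := u x)
        · simp [s, hx]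
        · simp
      simp [indi, hx, this]

lemma dyson {ι : Type} [Fintype ι] : ∀ (n : ℕ) (U V : Submodule ℂ (ι → ℂ)),
    Module.finrank ℂ U ≤ n → (1 : ι → ℂ) ∈ U → (∀ P, ∃ v ∈ V, v P ≠ 0) →
    ∃ V' : Submodule ℂ (ι → ℂ), V ≤ V' ∧ V' ≤ U * V ∧
      (Module.finrank ℂ U + Module.finrank ℂ V ≤ Module.finrank ℂ V' + 1 ∨
        ∃ Y : Finset ι, (Y ≠ ∅ ∧ Y ≠ Finset.univ) ∧ ∀ v ∈ V', indi Y * v ∈ V') := by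
  intro n
  induction n with
  | zero =>
    intro U V hU h1 hV
    refine ⟨V, le_rfl, fun v hv => ?_, Or.inl (by omega)⟩
    have := Submodule.mul_mem_mul h1 hv
    rwa [one_mul] at this
  | succ n ih =>
    intro U V hU h1 hV
    by_cases hst : ∀ e ∈ V, (∀ P, e P ≠ 0) → ∀ u ∈ U, u * e ∈ V
    · refine ⟨V, le_rfl, fun v hv => ?_, ?_⟩
      · have := Submodule.mul_mem_mul h1 hv
        rwa [one_mul] at this
      have hUV : ∀ u ∈ U, ∀ v ∈ V, u * v ∈ V := by
        intro u hu
        obtain ⟨_, hj⟩ := union_lemma (κ := Unit) V hV (fun _ => V.comap (mulL u))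
          (fun v hv h => ⟨(), hst v hv h u hu⟩)
        exact fun v hv => hj hv
      by_cases hconst : ∀ u ∈ U, ∀ p q, u p = u q
      · left
        have hle : U ≤ Submodule.span ℂ {(1 : ι → ℂ)} := by
          intro u hu
          rw [Submodule.mem_span_singleton]
          by_cases hne : Nonempty ι
          · obtain ⟨p⟩ := hne
            exact ⟨u p, by funext q; simpa using hconst u hu p q⟩
          · exact ⟨0, by funext q; exact absurd ⟨q⟩ hne⟩
        have h2 := Submodule.finrank_mono hle
        have h3 : Module.finrank ℂ (Submodule.span ℂ {(1 : ι → ℂ)}) ≤ 1 := by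
          simpa using finrank_span_le_card (R := ℂ) ({(1 : ι → ℂ)} : Set (ι → ℂ))
        omega
      · right
        push Not at hconst
        obtain ⟨u, hu, p, q, hpq⟩ := hconst
        exact stable_indicator V u (hUV u hu) p q hpq
    · push Not at hst
      obtain ⟨e, heV, he, u0, hu0, hu0e⟩ := hst
      let U1 := U ⊓ V.comap (mulL e)
      let V1 := V ⊔ U.map (mulL e)
      have hlt : U1 < U := by
        refine lt_of_le_of_ne inf_le_left fun h => hu0e ?_
        rw [← h] at hu0
        have := hu0.2
        simpa [mul_comm] using this
      have hf := Submodule.finrank_lt_finrank_of_lt hlt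
      have hmap : U1.map (mulL e) = V ⊓ U.map (mulL e) := by
        ext f
        constructor
        · rintro ⟨g, ⟨hg1, hg2⟩, rfl⟩
          exact ⟨hg2, ⟨g, hg1, rfl⟩⟩
        · rintro ⟨hf, ⟨g, hg, rfl⟩⟩
          exact ⟨g, ⟨hg, hf⟩, rfl⟩
      have hsum := Submodule.finrank_sup_add_finrank_inf_eq V (U.map (mulL e))
      rw [← hmap, finrank_mulL e he, finrank_mulL e he] at hsum
      have hmul : U1 * V1 ≤ U * V := by
        rw [Submodule.mul_le]
        rintro u ⟨hu1, hu2⟩ v hv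
        obtain ⟨v1, hv1, _, ⟨w, hw, rfl⟩, rfl⟩ := Submodule.mem_sup.mp hv
        rw [mul_add]
        refine Submodule.add_mem _ (Submodule.mul_mem_mul hu1 hv1) ?_
        have : u * mulL e w = w * (e * u) := by simp; ring
        rw [this]
        exact Submodule.mul_mem_mul hw hu2
      obtain ⟨V', h4, h5, h6⟩ := ih U1 V1 (by omega)
        ⟨h1, by simpa using heV⟩ (fun P => by
          obtain ⟨v, hv, hvP⟩ := hV P
          exact ⟨v, Submodule.mem_sup_left hv, hvP⟩)
      refine ⟨V', le_trans le_sup_left h4, h5.trans hmul, ?_⟩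
      rcases h6 with h6 | h6
      · left; change _ + Module.finrank ℂ ↥(V ⊔ U.map (mulL e)) ≤ _ at h6; omega
      · right; exact h6

lemma kneser {ι : Type} [Fintype ι] (U V : Submodule ℂ (ι → ℂ))
    (hU : ∀ P, ∃ v ∈ U, v P ≠ 0) (hV : ∀ P, ∃ v ∈ V, v P ≠ 0) :
    Module.finrank ℂ U + Module.finrank ℂ V ≤ Module.finrank ℂ ↥(U * V) + 1 ∨
      ∃ Y : Finset ι, (Y ≠ ∅ ∧ Y ≠ Finset.univ) ∧ ∀ v ∈ U * V, indi Y * v ∈ U * V := by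
  by_contra hcon
  rw [not_or] at hcon
  obtain ⟨hn, hY⟩ := hcon
  apply hY
  let N : {Y : Finset ι // Y ≠ ∅ ∧ Y ≠ Finset.univ} → Submodule ℂ (ι → ℂ) := fun Y =>
    ⨅ v : V, (U * V).comap (mulL (indi Y.1 * v.1))
  have hN : ∀ Y x, x ∈ N Y ↔ ∀ v ∈ V, indi Y.1 * v * x ∈ U * V := by
    intro Y x
    simp [N, Submodule.mem_iInf]
  obtain ⟨Y, hY'⟩ := union_lemma U hU N (by
    intro x hx hx0
    have hx0' : ∀ P, x⁻¹ P ≠ 0 := fun P => by simpa using hx0 P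
    have hxx : x * x⁻¹ = 1 := by funext P; simp [hx0 P]
    obtain ⟨V', h1, h2, h3⟩ := dyson (Module.finrank ℂ (U.map (mulL x⁻¹))) (U.map (mulL x⁻¹)) V
      le_rfl ⟨x, hx, by simpa [mul_comm] using hxx⟩ hV
    have hsub : V'.map (mulL x) ≤ U * V := by
      have h4 : U.map (mulL x⁻¹) * V ≤ (U * V).comap (mulL x) := by
        rw [Submodule.mul_le]
        rintro _ ⟨u, hu, rfl⟩ v hv
        have : x * (x⁻¹ * u * v) = u * v := by
          rw [← mul_assoc, ← mul_assoc, hxx, one_mul]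
        simpa [this] using Submodule.mul_mem_mul hu hv
      exact Submodule.map_le_iff_le_comap.mpr (h2.trans h4)
    rcases h3 with h3 | ⟨Y, hYn, hYs⟩
    · exfalso
      have h5 := Submodule.finrank_mono hsub
      rw [finrank_mulL x hx0] at h5
      rw [finrank_mulL _ hx0'] at h3
      omega
    · refine ⟨⟨Y, hYn⟩, (hN _ _).mpr fun v hv => ?_⟩
      have := hsub ⟨_, hYs v (h1 hv), rfl⟩
      simpa [mul_comm] using this)
  refine ⟨Y.1, Y.2, ?_⟩
  have : U * V ≤ (U * V).comap (mulL (indi Y.1)) := by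
    refine Submodule.mul_le.mpr ?_
    intro u hu v hv
    have := (hN Y u).mp (hY' hu) v hv
    simp only [Submodule.mem_comap, mulL_apply]
    convert this using 1
    ring
  exact fun v hv => this hv

/-- orthogonal complement for the dot product -/
def orth {ι : Type} [Fintype ι] (X : Submodule ℂ (ι → ℂ)) : Submodule ℂ (ι → ℂ) :=
  X.dualAnnihilator.comap (dotProductEquiv ℂ ι).toLinearMap

lemma mem_orth {ι : Type} [Fintype ι] (X : Submodule ℂ (ι → ℂ)) (g : ι → ℂ) :
    g ∈ orth X ↔ ∀ x ∈ X, ∑ P, g P * x P = 0 := by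
  simp [orth, Submodule.mem_dualAnnihilator, dotProduct]

lemma finrank_orth {ι : Type} [Fintype ι] (X : Submodule ℂ (ι → ℂ)) :
    Module.finrank ℂ X + Module.finrank ℂ (orth X) = Fintype.card ι := by
  have h := Subspace.finrank_add_finrank_dualAnnihilator_eq (K := ℂ) (V := ι → ℂ) X
  have h2 : Module.finrank ℂ (orth X) = Module.finrank ℂ X.dualAnnihilator := by
    have := LinearEquiv.finrank_map_eq (dotProductEquiv ℂ ι).symm X.dualAnnihilator
    rw [← this, orth, Submodule.map_equiv_eq_comap_symm]; rfl
  rw [h2, h]; simp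

lemma splitting {ι : Type} [Fintype ι] (U V W : Submodule ℂ (ι → ℂ))
    (hU : ∀ P, ∃ v ∈ U, v P ≠ 0) (hV : ∀ P, ∃ v ∈ V, v P ≠ 0)
    (g : ι → ℂ) (hg : ∀ P, g P ≠ 0)
    (h0 : ∀ f ∈ U * V * W, ∑ P, g P * f P = 0)
    (hirr : ∀ Y : Finset ι, Y ≠ ∅ → Y ≠ Finset.univ →
      ∃ f ∈ U * V * W, ∑ P ∈ Y, g P * f P ≠ 0) :
    Module.finrank ℂ U + Module.finrank ℂ V + Module.finrank ℂ W ≤ Fintype.card ι + 1 := by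
  have h1 : Module.finrank ℂ U + Module.finrank ℂ V ≤ Module.finrank ℂ ↥(U * V) + 1 := by
    rcases kneser U V hU hV with h | ⟨Y, ⟨hY1, hY2⟩, hs⟩
    · exact h
    · exfalso
      obtain ⟨f, hf, hne⟩ := hirr Y hY1 hY2
      apply hne
      have h2 : U * V * W ≤ (U * V * W).comap (mulL (indi Y)) := by
        refine Submodule.mul_le.mpr ?_
        intro x hx w hw
        simp only [Submodule.mem_comap, mulL_apply, ← mul_assoc]
        exact Submodule.mul_mem_mul (hs x hx) hw
      have := h0 _ (h2 hf)
      rw [← this]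
      simp [indi, Finset.sum_ite_mem]
  have h2 : W ≤ orth ((U * V).map (mulL g)) := by
    intro w hw
    rw [mem_orth]
    rintro _ ⟨x, hx, rfl⟩
    rw [← h0 _ (Submodule.mul_mem_mul hx hw)]
    refine Finset.sum_congr rfl fun P _ => ?_
    simp; ring
  have h3 := Submodule.finrank_mono h2
  have h4 := finrank_orth ((U * V).map (mulL g))
  rw [finrank_mulL g hg] at h4
  omega

/-- span of the coordinate functions on a family of points -/
def V1 {m : ℕ} {ι : Type} (p : ι → Fin (m + 1) → ℂ) : Submodule ℂ (ι → ℂ) :=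
  Submodule.span ℂ (Set.range fun i => fun P => p P i)

lemma coord_mem {m : ℕ} {ι : Type} (p : ι → Fin (m + 1) → ℂ) (i : Fin (m + 1)) :
    (fun P => p P i) ∈ V1 p := Submodule.subset_span ⟨i, rfl⟩

lemma pderiv_linForm {m : ℕ} (v : Fin (m + 1) → ℂ) (i : Fin (m + 1)) (k : ℕ) :
    pderiv i (linForm v ^ (k + 1)) = ((k + 1 : ℂ) * v i) • linForm v ^ k := by
  have h : pderiv i (linForm v) = MvPolynomial.C (v i) := by
    simp [linForm, pderiv_X, Pi.single_apply]
  rw [Derivation.leibniz_pow, h]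
  simp [smul_eq_C_mul]
  ring

lemma orth_pow_succ {m : ℕ} {ι : Type} [Fintype ι] (p : ι → Fin (m + 1) → ℂ) (k : ℕ)
    (g : ι → ℂ) : g ∈ orth (V1 p ^ (k + 1)) ↔
      ∀ i, (fun P => g P * p P i) ∈ orth (V1 p ^ k) := by
  constructor
  · intro h i
    rw [mem_orth] at h ⊢
    intro f hf
    have := h (f * fun P => p P i) (by
      rw [pow_succ]; exact Submodule.mul_mem_mul hf (coord_mem p i))
    rw [← this]
    refine Finset.sum_congr rfl fun P _ => ?_
    simp; ring
  · intro h
    rw [mem_orth]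
    have key : V1 p ^ (k + 1) ≤
        LinearMap.ker ((dotProductEquiv ℂ ι g : Module.Dual ℂ (ι → ℂ))) := by
      rw [pow_succ, Submodule.mul_le]
      intro f hf l hl
      induction hl using Submodule.span_induction with
      | mem x hx =>
        obtain ⟨i, rfl⟩ := hx
        have := (mem_orth _ _).mp (h i) f hf
        simp only [LinearMap.mem_ker, dotProductEquiv_apply_apply, dotProduct]
        rw [← this]
        refine Finset.sum_congr rfl fun P _ => ?_
        simp; ring
      | zero => simp
      | add x y _ _ hx hy => rw [mul_add]; exact Submodule.add_mem _ hx hy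
      | smul c x _ hx => rw [mul_smul_comm]; exact Submodule.smul_mem _ c hx
    intro f hf
    have := key hf
    simpa [dotProduct] using this

lemma duality {m : ℕ} {ι : Type} [Fintype ι] (p : ι → Fin (m + 1) → ℂ) (k : ℕ) :
    ∀ g : ι → ℂ, (∑ P, g P • linForm (p P) ^ k = 0) ↔ g ∈ orth (V1 p ^ k) := by
  induction k with
  | zero =>
    intro g
    rw [mem_orth]
    constructor
    · intro h f hf
      rw [pow_zero, Submodule.mem_one] at hf
      obtain ⟨c, rfl⟩ := hf
      have h2 : MvPolynomial.C (σ := Fin (m + 1)) (∑ P, g P) = 0 := by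
        rw [← h, map_sum]
        simp [smul_eq_C_mul]
      rw [MvPolynomial.C_eq_zero] at h2
      simp [← Finset.sum_mul, h2]
    · intro h
      have h1 := h 1 (by rw [pow_zero]; exact Submodule.one_le.mp le_rfl)
      simp only [Pi.one_apply, mul_one] at h1
      simp only [pow_zero]
      rw [← Finset.sum_smul, h1, zero_smul]
  | succ k ih =>
    intro g
    rw [orth_pow_succ]
    constructor
    · intro h i
      rw [← ih]
      have h1 := congrArg (pderiv i) h
      rw [map_sum, map_zero] at h1
      have hk : (k + 1 : ℂ) ≠ 0 := by exact_mod_cast Nat.succ_ne_zero k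
      have h2 : (k + 1 : ℂ) • ∑ P, (g P * p P i) • linForm (p P) ^ k = 0 := by
        rw [← h1, Finset.smul_sum]
        refine Finset.sum_congr rfl fun P _ => ?_
        rw [Derivation.map_smul, pderiv_linForm, smul_smul, smul_smul]
        congr 1; ring
      exact (smul_eq_zero.mp h2).resolve_left hk
    · intro h
      have h1 : ∑ P, g P • linForm (p P) ^ (k + 1) =
          ∑ i, (∑ P, (g P * p P i) • linForm (p P) ^ k) * MvPolynomial.X i := by
        simp_rw [Finset.sum_mul]
        rw [Finset.sum_comm]
        refine Finset.sum_congr rfl fun P _ => ?_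
        rw [pow_succ]
        conv_lhs => rw [linForm, Finset.mul_sum, Finset.smul_sum]
        refine Finset.sum_congr rfl fun i _ => ?_
        simp [smul_eq_C_mul, linForm]
        ring
      rw [h1]
      refine Finset.sum_eq_zero fun i _ => ?_
      rw [(ih _).mpr (h i), zero_mul]

lemma finrank_V1 {m : ℕ} {ι : Type} [Fintype ι] (p : ι → Fin (m + 1) → ℂ) (k : ℕ) :
    Module.finrank ℂ ↥(V1 p ^ k) =
      Module.finrank ℂ (Submodule.span ℂ (Set.range fun P => linForm (p P) ^ k)) := by
  have h1 := finrank_orth (V1 p ^ k)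
  have h2 : orth (V1 p ^ k) =
      LinearMap.ker (Fintype.linearCombination ℂ (fun P => linForm (p P) ^ k)) := by
    ext g
    rw [← duality, LinearMap.mem_ker, Fintype.linearCombination_apply]
  have h3 := LinearMap.finrank_range_add_finrank_ker
    (Fintype.linearCombination ℂ (fun P => linForm (p P) ^ k))
  rw [← h2, Fintype.range_linearCombination] at h3
  simp only [Module.finrank_fintype_fun_eq_card] at h3
  omega

lemma kruskal_spec {m : ℕ} (k : ℕ) (A : Finset (Pt m)) : kruskalRank k A ≤ A.card ∧
    ∀ S ⊆ A, S.card ≤ kruskalRank k A → LinearIndependent ℂ (fun P : S => powRep k P.1) := by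
  have := Nat.sSup_mem (s := {n | n ≤ A.card ∧ ∀ S ⊆ A, S.card ≤ n →
    LinearIndependent ℂ (fun P : S => powRep k P.1)}) ⟨0, Nat.zero_le _, fun S _ hS => by
      have : S = ∅ := by simpa using hS
      subst this
      exact linearIndependent_empty_type⟩ ⟨A.card, fun n hn => hn.1⟩
  exact this

lemma rank_lemma {m : ℕ} (k : ℕ) (A Y : Finset (Pt m)) :
    min (kruskalRank k A) (A ∩ Y).card ≤
      Module.finrank ℂ ↥(V1 (fun P : Y => P.1.rep) ^ k) := by
  obtain ⟨S, hS, hc⟩ := Finset.exists_subset_card_eq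
    (min_le_right (kruskalRank k A) (A ∩ Y).card)
  have hli := (kruskal_spec k A).2 S (hS.trans Finset.inter_subset_left)
    (by rw [hc]; exact min_le_left _ _)
  rw [finrank_V1, ← hc]
  have h1 := finrank_span_eq_card hli
  rw [Fintype.card_coe] at h1
  rw [← h1]
  have : FiniteDimensional ℂ (Submodule.span ℂ
      (Set.range fun P : Y => linForm (P.1.rep) ^ k)) :=
    FiniteDimensional.span_of_finite ℂ (Set.finite_range _)
  apply Submodule.finrank_mono
  apply Submodule.span_mono
  rintro _ ⟨P, rfl⟩
  exact ⟨⟨P.1, (Finset.mem_inter.mp (hS P.2)).2⟩, rfl⟩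

lemma exists_coord {m : ℕ} (P : Pt m) : ∃ i, P.rep i ≠ 0 := by
  by_contra h
  push Not at h
  exact P.rep_nonzero (funext h)

lemma exists_minor {m : ℕ} (P Q : Pt m) (h : P ≠ Q) :
    ∃ i j, Q.rep j * P.rep i - Q.rep i * P.rep j ≠ 0 := by
  by_contra hcon
  push Not at hcon
  apply h
  obtain ⟨j, hj⟩ := exists_coord Q
  rw [← P.mk_rep, ← Q.mk_rep, Projectivization.mk_eq_mk_iff']
  refine ⟨P.rep j / Q.rep j, ?_⟩
  funext i
  have := hcon i j
  simp only [Pi.smul_apply, smul_eq_mul]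
  field_simp
  linear_combination -this

lemma small_case {m : ℕ} (d : ℕ) (hd : 1 ≤ d) (Y : Finset (Pt m)) (P : Pt m) (hP : P ∈ Y)
    (hY : Y.card ≤ 2) (g : Y → ℂ) (hg : g ⟨P, hP⟩ ≠ 0)
    (h : g ∈ orth (V1 (fun P : Y => P.1.rep) ^ d)) : False := by
  obtain ⟨i, hi⟩ := exists_coord P
  have key : ∃ f ∈ V1 (fun P : Y => P.1.rep), f ⟨P, hP⟩ ≠ 0 ∧ ∀ Q : Y, Q.1 ≠ P → f Q = 0 := by
    by_cases hQ : ∃ Q ∈ Y, Q ≠ P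
    · obtain ⟨Q, hQY, hQP⟩ := hQ
      obtain ⟨s, t, hst⟩ := exists_minor P Q hQP.symm
      refine ⟨_, Submodule.sub_mem _ (Submodule.smul_mem _ (Q.rep t) (coord_mem _ s))
        (Submodule.smul_mem _ (Q.rep s) (coord_mem _ t)), by simpa using hst, ?_⟩
      intro R hR
      have : R.1 = Q := by
        by_contra hRQ
        have h3 : ({P, Q, R.1} : Finset (Pt m)) ⊆ Y := by
          intro x hx
          simp only [Finset.mem_insert, Finset.mem_singleton] at hx
          rcases hx with rfl | rfl | rfl
          · exact hP
          · exact hQY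
          · exact R.2
        have h4 := Finset.card_le_card h3
        rw [Finset.card_eq_three.mpr ⟨P, Q, R.1, hQP.symm, hR.symm, fun e => hRQ e.symm, rfl⟩] at h4
        omega
      simp [this, mul_comm]
    · push Not at hQ
      exact ⟨_, coord_mem _ i, hi, fun Q hQ' => absurd (hQ Q.1 Q.2) hQ'⟩
  obtain ⟨f, hf, hfP, hf0⟩ := key
  obtain ⟨e, rfl⟩ : ∃ e, d = e + 1 := ⟨d - 1, by omega⟩
  have h1 := (mem_orth _ _).mp h _ (by
    rw [pow_succ]
    exact Submodule.mul_mem_mul (Submodule.pow_mem_pow _ (coord_mem _ i) e) hf)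
  rw [Finset.sum_eq_single ⟨P, hP⟩] at h1
  · simp [hg, hfP, hi] at h1
  · intro Q _ hQ
    have : f Q = 0 := hf0 Q fun e => hQ (Subtype.ext e)
    simp [this]
  · simp

lemma bpf {m : ℕ} (k : ℕ) (Y : Finset (Pt m)) (P : Y) :
    ∃ v ∈ V1 (fun P : Y => P.1.rep) ^ k, v P ≠ 0 := by
  obtain ⟨i, hi⟩ := exists_coord P.1
  exact ⟨_, Submodule.pow_mem_pow _ (coord_mem _ i) k, by simp [hi]⟩

lemma no_bad {m : ℕ} (d a b c : ℕ) (ha : 1 ≤ a) (habc : a + b + c = d)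
    (A B : Finset (Pt m))
    (hineq : 2 * A.card + 2 ≤ kruskalRank a A + kruskalRank b A + kruskalRank c A)
    (g : Pt m → ℂ) : ∀ Y : Finset (Pt m), Y ⊆ A ∪ B → (∀ P ∈ Y, g P ≠ 0) →
      ∑ P ∈ Y, g P • powRep d P = 0 → (A ∩ Y).Nonempty → (B ∩ Y).card ≤ (A ∩ Y).card →
      False := by
  intro Y
  induction Y using Finset.strongInduction with
  | H Y ih =>
  intro hsub hg hrel hne hcard
  have hnep : ∀ Y' ⊆ Y, Y'.Nonempty → (B ∩ Y').card ≤ (A ∩ Y').card → (A ∩ Y').Nonempty := by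
    intro Y' hY' hn hc
    by_contra h
    rw [Finset.not_nonempty_iff_eq_empty] at h
    rw [h, Finset.card_empty, Nat.le_zero, Finset.card_eq_zero] at hc
    obtain ⟨x, hx⟩ := hn
    rcases Finset.mem_union.mp (hsub (hY' hx)) with h1 | h1
    · exact absurd (Finset.mem_inter.mpr ⟨h1, hx⟩) (by simp [h])
    · exact absurd (Finset.mem_inter.mpr ⟨h1, hx⟩) (by simp [hc])
  have hirr : ∀ Y' ⊂ Y, Y'.Nonempty → ∑ P ∈ Y', g P • powRep d P ≠ 0 := by
    intro Y' hY' hn h0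
    have hs := Finset.sum_sdiff (f := fun P => g P • powRep d P) hY'.1
    rw [h0, hrel, add_zero] at hs
    have hsplit : ∀ D : Finset (Pt m), (D ∩ Y).card = (D ∩ Y').card + (D ∩ (Y \ Y')).card := by
      intro D
      rw [← Finset.card_union_of_disjoint, ← Finset.inter_union_distrib_left,
        Finset.union_sdiff_of_subset hY'.1]
      exact Finset.disjoint_of_subset_left Finset.inter_subset_right
        (Finset.disjoint_of_subset_right Finset.inter_subset_right Finset.disjoint_sdiff)
    have hA := hsplit A
    have hB := hsplit B
    by_cases hc : (B ∩ Y').card ≤ (A ∩ Y').card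
    · exact ih Y' hY' (hY'.1.trans hsub) (fun P hP => hg P (hY'.1 hP)) h0
        (hnep Y' hY'.1 hn hc) hc
    · have hc' : (B ∩ (Y \ Y')).card ≤ (A ∩ (Y \ Y')).card := by omega
      exact ih (Y \ Y') (Finset.sdiff_ssubset hY'.1 hn) (Finset.sdiff_subset.trans hsub)
        (fun P hP => hg P (Finset.sdiff_subset hP)) hs
        (hnep _ Finset.sdiff_subset (Finset.sdiff_nonempty.mpr hY'.2) hc') hc'
  have hYc : Y.card ≤ (A ∩ Y).card + (B ∩ Y).card := by
    have : Y ⊆ (A ∩ Y) ∪ (B ∩ Y) := by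
      rw [← Finset.union_inter_distrib_right]
      exact Finset.subset_inter hsub (Finset.Subset.refl _)
    exact (Finset.card_le_card this).trans (Finset.card_union_le _ _)
  have horth : (fun P : Y => g P.1) ∈ orth (V1 (fun P : Y => P.1.rep) ^ d) := by
    rw [← duality]
    exact (Finset.sum_coe_sort Y (fun P => g P • powRep d P)).trans hrel
  have hs1 : 1 ≤ (A ∩ Y).card := Finset.card_pos.mpr hne
  by_cases hs : (A ∩ Y).card = 1
  · obtain ⟨P, hP⟩ := hne
    have hPY := (Finset.mem_inter.mp hP).2
    exact small_case d (by omega) Y P hPY (by omega) _ (hg P hPY) horth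
  · have hpow : V1 (fun P : Y => P.1.rep) ^ a * V1 (fun P : Y => P.1.rep) ^ b *
        V1 (fun P : Y => P.1.rep) ^ c = V1 (fun P : Y => P.1.rep) ^ d := by
      rw [← pow_add, ← pow_add, habc]
    have hmain := splitting (V1 (fun P : Y => P.1.rep) ^ a) (V1 (fun P : Y => P.1.rep) ^ b)
      (V1 (fun P : Y => P.1.rep) ^ c) (bpf a Y) (bpf b Y) (fun P : Y => g P.1)
      (fun P => hg P.1 P.2) (by
        rw [hpow]; exact (mem_orth _ _).mp horth) (by
        intro T hT hTu
        rw [hpow]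
        by_contra hcon
        push Not at hcon
        have h1 : (fun P : Y => if P ∈ T then g P.1 else 0) ∈
            orth (V1 (fun P : Y => P.1.rep) ^ d) := by
          rw [mem_orth]
          intro f hf
          refine Eq.trans ?_ (hcon f hf)
          simp only [ite_mul, zero_mul, Finset.sum_ite_mem, Finset.univ_inter]
        rw [← duality] at h1
        have hlt : T.map (Function.Embedding.subtype _) ⊂ Y := by
          refine ⟨fun x hx => ?_, fun h => hTu ?_⟩
          · obtain ⟨z, _, rfl⟩ := Finset.mem_map.mp hx
            exact z.2
          · rw [Finset.eq_univ_iff_forall]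
            intro x
            obtain ⟨z, hz, hzx⟩ := Finset.mem_map.mp (h x.2)
            have : z = x := Subtype.ext hzx
            rwa [← this]
        refine hirr _ hlt (Finset.Nonempty.map (Finset.nonempty_iff_ne_empty.mpr hT)) ?_
        rw [Finset.sum_map]
        simp only [ite_smul, zero_smul, Finset.sum_ite_mem, Finset.univ_inter] at h1
        exact h1)
    rw [Fintype.card_coe] at hmain
    have ra := rank_lemma a A Y
    have rb := rank_lemma b A Y
    have rc := rank_lemma c A Y
    have ka := (kruskal_spec a A).1
    have kb := (kruskal_spec b A).1
    have kc := (kruskal_spec c A).1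
    have hsr : (A ∩ Y).card ≤ A.card := Finset.card_le_card Finset.inter_subset_left
    omega

lemma subset_lemma {m : ℕ} (d a b c : ℕ) (ha : 1 ≤ a) (habc : a + b + c = d)
    (A B : Finset (Pt m))
    (hineq : 2 * A.card + 2 ≤ kruskalRank a A + kruskalRank b A + kruskalRank c A)
    (al be : Pt m → ℂ) (hal : ∀ P ∈ A, al P ≠ 0)
    (heq : ∑ P ∈ A, al P • powRep d P = ∑ P ∈ B, be P • powRep d P)
    (hcard : B.card ≤ A.card) : B = A := by
  suffices h : A ⊆ B from (Finset.eq_of_subset_of_card_le h hcard).symm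
  by_contra hAB
  obtain ⟨P0, hP0, hP0B⟩ := Finset.not_subset.mp hAB
  let g : Pt m → ℂ := fun P => (if P ∈ A then al P else 0) - (if P ∈ B then be P else 0)
  let Y := (A ∪ B).filter (fun P => g P ≠ 0)
  refine no_bad d a b c ha habc A B hineq g Y (Finset.filter_subset _ _)
    (fun P hP => (Finset.mem_filter.mp hP).2) ?_ ⟨P0, ?_⟩ ?_
  · have h1 : ∑ P ∈ Y, g P • powRep d P = ∑ P ∈ A ∪ B, g P • powRep d P := by
      refine Finset.sum_subset (Finset.filter_subset _ _) fun P hP hPY => ?_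
      have : g P = 0 := by
        by_contra hne
        exact hPY (Finset.mem_filter.mpr ⟨hP, hne⟩)
      rw [this, zero_smul]
    rw [h1]
    simp only [g, sub_smul, Finset.sum_sub_distrib, ite_smul, zero_smul, Finset.sum_ite_mem]
    rw [Finset.union_inter_cancel_left, Finset.union_inter_cancel_right, heq, sub_self]
  · have : al P0 ≠ 0 := hal P0 hP0
    simp [Y, g, hP0, hP0B, this]
  · have hsub : A \ Y ⊆ B \ Y := by
      intro P hP
      obtain ⟨hPA, hPY⟩ := Finset.mem_sdiff.mp hP
      refine Finset.mem_sdiff.mpr ⟨?_, hPY⟩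
      by_contra hPB
      apply hPY
      have : al P ≠ 0 := hal P hPA
      simp [Y, g, hPA, hPB, this]
    have h1 := Finset.card_le_card hsub
    have h2 := Finset.card_inter_add_card_sdiff A Y
    have h3 := Finset.card_inter_add_card_sdiff B Y
    omega

/-- Reshaped Kruskal criterion: if `d = a+b+c` with `a,b,c ≥ 1` and
`r ≤ (k_a + k_b + k_c - 2)/2` (i.e. `2r + 2 ≤ k_a + k_b + k_c`), then `T` has rank `r`
and is identifiable: `A` has minimal length among all decompositions and is the unique
decomposition of length at most `r`. -/
theorem stmt7 (m d a b c : ℕ) (ha : 1 ≤ a) (hb : 1 ≤ b) (hc : 1 ≤ c)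
    (habc : a + b + c = d)
    (T : MvPolynomial (Fin (m + 1)) ℂ) (hT0 : T ≠ 0) (hThom : T.IsHomogeneous d)
    (A : Finset (Pt m)) (hA : IsDecomp d A T) (hAnr : NonRedundant d A T)
    (hineq : 2 * A.card + 2 ≤ kruskalRank a A + kruskalRank b A + kruskalRank c A) :
    (∀ B : Finset (Pt m), IsDecomp d B T → A.card ≤ B.card) ∧
      (∀ B : Finset (Pt m), IsDecomp d B T → B.card ≤ A.card → B = A) := by
  obtain ⟨al, hal⟩ := hA
  have hal0 : ∀ P ∈ A, al P ≠ 0 := by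
    intro P hP h0
    refine hAnr (A.erase P) (Finset.erase_ssubset hP) ?_
    rw [hal, ← Finset.add_sum_erase A _ hP, h0, zero_smul, zero_add]
    refine Submodule.sum_mem _ fun Q hQ => Submodule.smul_mem _ _ (Submodule.subset_span ⟨Q, hQ, rfl⟩)
  have main : ∀ B : Finset (Pt m), IsDecomp d B T → B.card ≤ A.card → B = A := by
    rintro B ⟨be, hbe⟩ hc
    exact subset_lemma d a b c ha habc A B hineq al be hal0 (hal.symm.trans hbe) hc
  refine ⟨fun B hB => ?_, main⟩
  by_contra hlt
  push Not at hlt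
  have := main B hB hlt.le
  rw [this] at hlt
  exact lt_irrefl _ hlt

end
end

section
/- Let Z ⊂ ℙ^m be a finite set satisfying the Cayley–Bacharach property CB(i). Then for every integer j with 0 ≤ j ≤ i+1, one has Dh_Z(0) + Dh_Z(1) + ⋯ + Dh_Z(j) ≤ Dh_Z(i+1−j) + Dh_Z(i+2−j) + ⋯ + Dh_Z(i+1). -/
open MvPolynomial
open scoped Classical

noncomputable section

theorem aux_rank {M A B : Type*} [AddCommGroup M] [Module ℂ M] [AddCommGroup A] [Module ℂ A]
    [AddCommGroup B] [Module ℂ B] [FiniteDimensional ℂ A]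
    (f : M →ₗ[ℂ] A) (g : M →ₗ[ℂ] B) (h : LinearMap.ker f ≤ LinearMap.ker g) :
    Module.finrank ℂ (LinearMap.range g) ≤ Module.finrank ℂ (LinearMap.range f) := by
  have h1 : LinearMap.range (((LinearMap.ker f).liftQ g h).comp
      (f.quotKerEquivRange.symm : LinearMap.range f →ₗ[ℂ] M ⧸ LinearMap.ker f))
      = LinearMap.range g := by
    rw [LinearEquiv.range_comp, Submodule.range_liftQ]
  rw [← h1]
  exact LinearMap.finrank_range_le _

theorem aux_coord {m : ℕ} (P : Pt m) : ∃ a, P.rep a ≠ 0 := by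
  by_contra h
  push Not at h
  exact P.rep_nonzero (funext h)

theorem aux_sep {m : ℕ} (P Q : Pt m) (hPQ : Q ≠ P) :
    ∃ F : MvPolynomial (Fin (m + 1)) ℂ, F.IsHomogeneous 1 ∧ eval P.rep F = 0 ∧
      eval Q.rep F ≠ 0 := by
  by_contra h
  push Not at h
  obtain ⟨a, ha⟩ := aux_coord P
  have key : ∀ b, P.rep a * Q.rep b = P.rep b * Q.rep a := by
    intro b
    have := h (C (P.rep a) * X b - C (P.rep b) * X a)
      (((isHomogeneous_C_mul_X _ _)).sub (isHomogeneous_C_mul_X _ _))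
      (by simp; ring)
    simp at this
    linear_combination this
  apply hPQ
  rw [← P.mk_rep, ← Q.mk_rep, Projectivization.mk_eq_mk_iff']
  refine ⟨Q.rep a / P.rep a, ?_⟩
  funext b
  have := key b
  simp only [Pi.smul_apply, smul_eq_mul]
  field_simp
  linear_combination -this

theorem aux_mem_ker {m : ℕ} (Z : Finset (Pt m)) (d : ℕ)
    (F : homogeneousSubmodule (Fin (m + 1)) ℂ d) :
    F ∈ LinearMap.ker (evalMap Z d) ↔ ∀ P ∈ Z, eval P.rep F.1 = 0 := by
  rw [LinearMap.mem_ker]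
  constructor
  · intro h P hP
    exact congrFun h ⟨P, hP⟩
  · intro h
    funext P
    exact h P.1 P.2

theorem aux_subset {m : ℕ} (k : ℕ) (Z : Finset (Pt m)) :
    ∃ Y ⊆ Z, (∀ F : MvPolynomial (Fin (m + 1)) ℂ, F.IsHomogeneous k →
      (∀ P ∈ Y, eval P.rep F = 0) → ∀ P ∈ Z, eval P.rep F = 0) ∧
      ∀ P ∈ Y, ∃ F : MvPolynomial (Fin (m + 1)) ℂ, F.IsHomogeneous k ∧
        (∀ Q ∈ Y.erase P, eval Q.rep F = 0) ∧ eval P.rep F ≠ 0 := by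
  induction hn : Z.card generalizing Z with
  | zero =>
    obtain rfl := Finset.card_eq_zero.1 hn
    exact ⟨∅, by simp⟩
  | succ n ih =>
    by_cases h : ∀ P ∈ Z, ∃ F : MvPolynomial (Fin (m + 1)) ℂ, F.IsHomogeneous k ∧
        (∀ Q ∈ Z.erase P, eval Q.rep F = 0) ∧ eval P.rep F ≠ 0
    · exact ⟨Z, subset_rfl, fun F _ h => h, h⟩
    · push Not at h
      obtain ⟨P, hP, h⟩ := h
      obtain ⟨Y, hY, h1, h2⟩ := ih (Z.erase P) (by rw [Finset.card_erase_of_mem hP, hn]; rfl)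
      refine ⟨Y, hY.trans (Finset.erase_subset _ _), ?_, h2⟩
      intro F hF hv Q hQ
      have h3 := h1 F hF hv
      by_cases hQP : Q = P
      · subst hQP
        exact h F hF h3
      · exact h3 Q (Finset.mem_erase.2 ⟨hQP, hQ⟩)

theorem aux_surj {m : ℕ} (k : ℕ) (Y : Finset (Pt m))
    (h : ∀ P ∈ Y, ∃ F : MvPolynomial (Fin (m + 1)) ℂ, F.IsHomogeneous k ∧
        (∀ Q ∈ Y.erase P, eval Q.rep F = 0) ∧ eval P.rep F ≠ 0) :
    hf Y k = Y.card := by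
  have htop : LinearMap.range (evalMap Y k) = ⊤ := by
    rw [eq_top_iff, ← (Pi.basisFun ℂ Y).span_eq, Submodule.span_le]
    rintro _ ⟨P, rfl⟩
    obtain ⟨F, hF, h0, h1⟩ := h P.1 P.2
    refine ⟨(eval P.1.rep F)⁻¹ • ⟨F, (mem_homogeneousSubmodule _ _).2 hF⟩, ?_⟩
    funext Q
    rw [map_smul]
    by_cases hQ : Q = P
    · subst hQ
      simp [evalMap, h1]
    · have : eval Q.1.rep F = 0 :=
        h0 Q.1 (Finset.mem_erase.2 ⟨fun h => hQ (Subtype.ext h), Q.2⟩)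
      simp [evalMap, this, hQ]
  rw [hf, htop]
  simp

theorem aux_dual {m : ℕ} (p q : ℕ) (Y : Finset (Pt m)) (h : CB (p + q) Y) :
    hf Y p + hf Y q ≤ Y.card := by
  set W := LinearMap.range (evalMap Y (p + q)) with hW
  have hex : ∀ P : Y, ∃ φ : W.dualAnnihilator, φ.1 (Pi.single P 1) ≠ 0 := by
    intro P
    have hn : (Pi.single P 1 : Y → ℂ) ∉ W := by
      rintro ⟨F, hF⟩
      have h1 := h P.1 P.2 F.1 ((mem_homogeneousSubmodule _ _).1 F.2) (by
        intro Q hQ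
        rw [Finset.mem_erase] at hQ
        have := congrFun hF ⟨Q, hQ.2⟩
        rw [Pi.single_eq_of_ne (fun h => hQ.1 (congrArg Subtype.val h))] at this
        exact this)
      have := congrFun hF P
      rw [Pi.single_eq_same] at this
      have h2 : eval P.1.rep F.1 = 1 := this
      rw [h1] at h2
      exact zero_ne_one h2
    obtain ⟨f, hf1, hf2⟩ := Submodule.exists_le_ker_of_notMem hn
    exact ⟨⟨f, (Submodule.mem_dualAnnihilator _).2 fun w hw => hf2 hw⟩, hf1⟩
  obtain ⟨φ, hφ⟩ : ∃ φ : W.dualAnnihilator, ∀ P : Y, φ.1 (Pi.single P 1) ≠ 0 := by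
    have := Module.Dual.exists_forall_ne_zero_of_forall_exists (K := ℂ) (M := W.dualAnnihilator)
      (f := fun P : Y => (Module.Dual.eval ℂ (Y → ℂ) (Pi.single P 1)).comp
        W.dualAnnihilator.subtype) (fun P => hex P)
    exact this
  let T : (Y → ℂ) →ₗ[ℂ] Module.Dual ℂ (Y → ℂ) :=
    (LinearMap.compRight ℂ φ.1).comp (LinearMap.mul ℂ (Y → ℂ))
  have hT : ∀ a b, T a b = φ.1 (a * b) := fun a b => rfl
  have hinj : Function.Injective T := by
    rw [← LinearMap.ker_eq_bot, LinearMap.ker_eq_bot']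
    intro a ha
    funext P
    have h1 : T a (Pi.single P 1) = 0 := by rw [ha]; rfl
    rw [hT] at h1
    have h2 : a * Pi.single P 1 = a P • (Pi.single P 1 : Y → ℂ) := by
      funext Q
      by_cases hQ : Q = P
      · subst hQ; simp
      · simp [hQ]
    rw [h2, map_smul, smul_eq_mul] at h1
    exact (mul_eq_zero.1 h1).resolve_right (hφ P)
  have hle : (LinearMap.range (evalMap Y p)).map T ≤
      (LinearMap.range (evalMap Y q)).dualAnnihilator := by
    rintro _ ⟨_, ⟨F, rfl⟩, rfl⟩
    rw [Submodule.mem_dualAnnihilator]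
    rintro _ ⟨G, rfl⟩
    rw [hT]
    apply (Submodule.mem_dualAnnihilator _).1 φ.2
    refine ⟨⟨F.1 * G.1, (mem_homogeneousSubmodule _ _).2 (IsHomogeneous.mul
      ((mem_homogeneousSubmodule _ _).1 F.2) ((mem_homogeneousSubmodule _ _).1 G.2))⟩, ?_⟩
    funext P
    simp [evalMap]
  have h1 := Submodule.finrank_mono hle
  rw [← (Submodule.equivMapOfInjective T hinj _).finrank_eq] at h1
  have h2 := Subspace.finrank_add_finrank_dualAnnihilator_eq (LinearMap.range (evalMap Y q))
  rw [Module.finrank_fintype_fun_eq_card, Fintype.card_coe] at h2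
  unfold hf
  omega

theorem aux_main {m : ℕ} (p q : ℕ) (Z : Finset (Pt m)) (h : CB (p + q) Z) :
    hf Z p + hf Z q ≤ hf Z (p + q + 1) := by
  obtain ⟨Y, hYZ, h1, h2⟩ := aux_subset (p + q + 1) Z
  have hc := aux_surj _ Y h2
  have hge : hf Y (p + q + 1) ≤ hf Z (p + q + 1) := by
    apply aux_rank
    intro F hF
    rw [aux_mem_ker] at hF ⊢
    exact fun P hP => hF P (hYZ hP)
  have hle : ∀ d, d ≤ p + q + 1 → hf Z d ≤ hf Y d := by
    intro d hd
    apply aux_rank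
    intro F hF
    rw [aux_mem_ker] at hF ⊢
    intro P hP
    obtain ⟨a, ha⟩ := aux_coord P
    have hhom : (F.1 * X a ^ (p + q + 1 - d)).IsHomogeneous (p + q + 1) := by
      have := IsHomogeneous.mul ((mem_homogeneousSubmodule _ _).1 F.2)
        (isHomogeneous_X_pow (R := ℂ) a (p + q + 1 - d))
      rwa [Nat.add_sub_cancel' hd] at this
    have := h1 _ hhom (fun Q hQ => by simp [hF Q hQ]) P hP
    rw [map_mul, map_pow, eval_X] at this
    exact (mul_eq_zero.1 this).resolve_right (pow_ne_zero _ ha)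
  have hCB : CB (p + q) Y := by
    intro P hP F hF hv
    refine h P (hYZ hP) F hF ?_
    intro Q hQ
    rw [Finset.mem_erase] at hQ
    obtain ⟨L, hL, hLP, hLQ⟩ := aux_sep P Q hQ.1
    have := h1 (F * L) (hF.mul hL) (by
      intro R hR
      by_cases hRP : R = P
      · subst hRP; simp [hLP]
      · simp [hv R (Finset.mem_erase.2 ⟨hRP, hR⟩)]) Q hQ.2
    rw [map_mul] at this
    exact (mul_eq_zero.1 this).resolve_right hLQ
  have := aux_dual p q Y hCB
  have := hle p (by omega)
  have := hle q (by omega)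
  omega

theorem aux_sum {m : ℕ} (Z : Finset (Pt m)) (j : ℕ) :
    ∑ t ∈ Finset.range (j + 1), Dhf Z t = hf Z j := by
  induction j with
  | zero => simp [Dhf]
  | succ n ih => rw [Finset.sum_range_succ, ih]; simp [Dhf]

/-- If a finite set `Z ⊂ ℙ^m` satisfies `CB(i)`, then for every
`0 ≤ j ≤ i+1`,
`Dh_Z(0) + ⋯ + Dh_Z(j) ≤ Dh_Z(i+1-j) + ⋯ + Dh_Z(i+1)`. -/
theorem stmt10 (m i : ℕ) (Z : Finset (Pt m)) (hCB : CB i Z)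
    (j : ℕ) (hj : j ≤ i + 1) :
    ∑ t ∈ Finset.range (j + 1), Dhf Z t ≤
      ∑ t ∈ Finset.Icc (i + 1 - j) (i + 1), Dhf Z t := by
  rcases Nat.eq_or_lt_of_le hj with rfl | hlt
  · apply le_of_eq
    congr 1
    ext t
    simp
  · obtain ⟨q, rfl⟩ : ∃ q, i = j + q := ⟨i - j, by omega⟩
    have h1 : Finset.Icc (j + q + 1 - j) (j + q + 1) = Finset.Ico (q + 1) (j + q + 1 + 1) := by
      ext t
      simp only [Finset.mem_Icc, Finset.mem_Ico]
      omega
    rw [h1, Finset.sum_Ico_eq_sub _ (by omega), aux_sum, aux_sum, aux_sum]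
    have := aux_main j q Z hCB
    omega

end
end

section
/- Let Z ⊂ ℙ^m be a finite set of points and suppose that for some integer j > 0 one has Dh_Z(j) ≤ j. Then Dh_Z(j) ≥ Dh_Z(j+1), and hence Dh_Z(j) ≥ Dh_Z(i) for all i ≥ j. In particular, if Dh_Z(j) = 0 for some j > 0, then Dh_Z(i) = 0 for all i ≥ j. -/
open MvPolynomial
open scoped Classical

noncomputable section

lemma aux_surj_s13 {U M : Type*} [AddCommGroup U] [Module ℂ U] [AddCommGroup M] [Module ℂ M]
    [FiniteDimensional ℂ M] (f g : U →ₗ[ℂ] M) (hf : Function.Surjective f) :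
    ∃ t : ℂ, t ≠ 0 ∧ Function.Surjective (f + t • g) := by
  obtain ⟨s, hs⟩ := f.exists_rightInverse_of_surjective (LinearMap.range_eq_top.2 hf)
  have hfin := Module.End.finite_hasEigenvalue (g ∘ₗ s : Module.End ℂ M)
  obtain ⟨μ, hμ⟩ := (hfin.union (Set.finite_singleton (0 : ℂ))).exists_notMem
  simp only [Set.mem_union, Set.mem_ofPred_eq, Set.mem_singleton_iff, not_or] at hμ
  obtain ⟨h1, h0⟩ := hμ
  refine ⟨-μ⁻¹, by simpa using h0, ?_⟩
  have hinj : Function.Injective ((f + (-μ⁻¹) • g) ∘ₗ s) := by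
    rw [injective_iff_map_eq_zero]
    intro x hx
    by_contra hx0
    apply h1
    refine Module.End.hasEigenvalue_of_hasEigenvector (x := x)
      ⟨Module.End.mem_eigenspace_iff.2 ?_, hx0⟩
    have hsx : f (s x) = x := by simpa using LinearMap.congr_fun hs x
    simp only [LinearMap.comp_apply, LinearMap.add_apply, LinearMap.smul_apply, hsx] at hx ⊢
    have h2 : x = μ⁻¹ • g (s x) := by
      rw [neg_smul] at hx
      exact eq_of_sub_eq_zero (by rw [sub_eq_add_neg]; exact hx)
    conv_rhs => rw [h2]
    rw [smul_smul, mul_inv_cancel₀ h0, one_smul]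
  have := LinearMap.injective_iff_surjective.1 hinj
  rw [LinearMap.coe_comp] at this
  exact this.of_comp

lemma aux_key {E : Type*} [CommRing E] [Algebra ℂ E] (G : Submodule ℂ E)
    {V : Type*} [AddCommGroup V] [Module ℂ V] [FiniteDimensional ℂ V] (d : ℕ) :
    ∀ (π : E →ₗ[ℂ] V), Module.finrank ℂ ((G ^ (d + 1)).map π) ≤ d + 1 →
      ∃ l ∈ G, (G ^ (d + 1)).map π ≤ (G ^ d).map (π ∘ₗ LinearMap.mulLeft ℂ l) := by
  induction d with
  | zero =>
    intro π h
    by_contra! hc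
    have hz : ∀ l ∈ G, π l = 0 := by
      intro l hl
      by_contra hne
      apply hc l hl
      have hmem : π l ∈ (G ^ (0 + 1)).map π := ⟨l, by simpa using hl, rfl⟩
      have hsp : Submodule.span ℂ {π l} = (G ^ (0 + 1)).map π := by
        refine Submodule.eq_of_le_of_finrank_le ?_ ?_
        · rw [Submodule.span_singleton_le_iff_mem]; exact hmem
        · rw [finrank_span_singleton hne]; exact h
      rw [← hsp, Submodule.span_singleton_le_iff_mem]
      exact ⟨1, by rw [SetLike.mem_coe, pow_zero]; exact Submodule.one_le.1 le_rfl, by simp⟩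
    apply hc 0 (zero_mem _)
    rintro _ ⟨x, hx, rfl⟩
    rw [hz x (by simpa using hx)]
    exact zero_mem _
  | succ e ih =>
    intro π h
    let B : E → Submodule ℂ V := fun l => (G ^ (e + 1)).map (π ∘ₗ LinearMap.mulLeft ℂ l)
    have hfinset : (Set.range fun l : G => Module.finrank ℂ (B l)).Finite :=
      (Set.finite_le_nat (Module.finrank ℂ V)).subset (by
        rintro _ ⟨l, rfl⟩; exact Submodule.finrank_le _)
    obtain ⟨_, ⟨⟨l1, hl1⟩, rfl⟩, hmax⟩ := hfinset.exists_maximal ⟨_, ⟨0, rfl⟩⟩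
    have hmax' : ∀ l ∈ G, B l1 ≤ B l → B l = B l1 := by
      intro l hl hle
      refine (Submodule.eq_of_le_of_finrank_le hle ?_).symm
      exact hmax (y := Module.finrank ℂ (B l)) ⟨⟨l, hl⟩, rfl⟩ (Submodule.finrank_mono hle)
    have hB : ∀ l ∈ G, B l ≤ (G ^ (e + 1 + 1)).map π := by
      rintro l hl _ ⟨x, hx, rfl⟩
      exact ⟨l * x, by rw [pow_succ' G (e + 1)]; exact Submodule.mul_mem_mul hl hx, rfl⟩
    refine ⟨l1, hl1, ?_⟩
    by_contra hcon
    have hlt : Module.finrank ℂ (B l1) < Module.finrank ℂ ((G ^ (e + 1 + 1)).map π) :=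
      Submodule.finrank_lt_finrank_of_lt (lt_of_le_not_ge (hB l1 hl1) hcon)
    obtain ⟨l, hl, hle⟩ := ih (π ∘ₗ LinearMap.mulLeft ℂ l1) (by
      change Module.finrank ℂ (B l1) ≤ e + 1
      omega)
    change B l1 ≤ _ at hle
    have hmapsto : ∀ w ∈ G, ∀ x ∈ G ^ e, π (l1 * (w * x)) ∈ B l1 := by
      intro w hw x hx
      exact ⟨w * x, by rw [SetLike.mem_coe, pow_succ']; exact Submodule.mul_mem_mul hw hx, rfl⟩
    have hgood : ∀ l ∈ G, (∀ y ∈ B l1, ∃ x ∈ G ^ e, π (l1 * (l * x)) = y) → B l ≤ B l1 := by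
      intro l hl hs
      refine (hmax' l hl ?_).le
      intro y hy
      obtain ⟨x, hx, rfl⟩ := hs y hy
      exact ⟨l1 * x, by rw [SetLike.mem_coe, pow_succ']; exact Submodule.mul_mem_mul hl1 hx,
        by simp [mul_left_comm]⟩
    have hBl : B l ≤ B l1 := hgood l hl (fun y hy => by
      obtain ⟨x, hx, h⟩ := hle hy
      exact ⟨x, hx, h⟩)
    have hall : ∀ w ∈ G, B w ≤ B l1 := by
      intro w hw
      let F : E → (G ^ e : Submodule ℂ E) →ₗ[ℂ] V := fun w =>
        (π ∘ₗ LinearMap.mulLeft ℂ l1 ∘ₗ LinearMap.mulLeft ℂ w) ∘ₗ (G ^ e).subtype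
      let f : (G ^ e : Submodule ℂ E) →ₗ[ℂ] B l1 :=
        (F l).codRestrict (B l1) (fun x => hmapsto l hl x x.2)
      let g : (G ^ e : Submodule ℂ E) →ₗ[ℂ] B l1 :=
        (F w).codRestrict (B l1) (fun x => hmapsto w hw x x.2)
      obtain ⟨t, ht, hsurj⟩ := aux_surj_s13 f g (by
        rintro ⟨y, hy⟩
        obtain ⟨x, hx, h⟩ := hle hy
        exact ⟨⟨x, hx⟩, Subtype.ext h⟩)
      have h2 : B (l + t • w) ≤ B l1 := by
        refine hgood _ (add_mem hl (G.smul_mem t hw)) ?_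
        intro y hy
        obtain ⟨x, hx⟩ := hsurj ⟨y, hy⟩
        refine ⟨x, x.2, ?_⟩
        have : ((f + t • g) x : V) = y := congrArg Subtype.val hx
        rw [← this]
        change _ = π (l1 * (l * x)) + t • π (l1 * (w * x))
        simp [add_mul, mul_add]
      rintro _ ⟨x, hx, rfl⟩
      have e1 : π (l * x) ∈ B l1 := hBl ⟨x, hx, rfl⟩
      have e2 : π ((l + t • w) * x) ∈ B l1 := h2 ⟨x, hx, rfl⟩
      have e3 := (B l1).smul_mem t⁻¹ (sub_mem e2 e1)
      have e4 : t⁻¹ • (π ((l + t • w) * x) - π (l * x)) = π (w * x) := by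
        simp [add_mul, smul_smul, ht]
      rw [e4] at e3
      exact e3
    apply hcon
    rw [Submodule.map_le_iff_le_comap, pow_succ' G (e + 1), Submodule.mul_le]
    intro w hw x hx
    exact hall w hw ⟨x, hx, rfl⟩

lemma aux_main_s13 {E : Type*} [CommRing E] [Algebra ℂ E] [FiniteDimensional ℂ E]
    (G : Submodule ℂ E) (u : E) (hu : u ∈ G) (hinj : Function.Injective (LinearMap.mulLeft ℂ u))
    (d : ℕ)
    (h : Module.finrank ℂ ↥(G ^ (d + 1)) ≤ Module.finrank ℂ ↥(G ^ d) + (d + 1)) :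
    Module.finrank ℂ ↥(G ^ (d + 2)) + Module.finrank ℂ ↥(G ^ d) ≤
      2 * Module.finrank ℂ ↥(G ^ (d + 1)) := by
  let N : ℕ → Submodule ℂ E := fun d => (G ^ d).map (LinearMap.mulLeft ℂ u)
  have hN : ∀ d, Module.finrank ℂ (N d) = Module.finrank ℂ ↥(G ^ d) := fun d =>
    (LinearEquiv.finrank_eq (Submodule.equivMapOfInjective _ hinj (G ^ d))).symm
  have hNle : ∀ d, N d ≤ G ^ (d + 1) := by
    rintro d _ ⟨x, hx, rfl⟩
    rw [pow_succ']; exact Submodule.mul_mem_mul hu hx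
  obtain ⟨C, hC⟩ := Submodule.exists_isCompl ((N d).comap (G ^ (d+1)).subtype)
  let U : Submodule ℂ E := C.map (G ^ (d+1)).subtype
  have hsup : N d ⊔ U = G ^ (d + 1) := by
    have := congrArg (Submodule.map (G ^ (d+1)).subtype) hC.sup_eq_top
    rw [Submodule.map_sup, Submodule.map_comap_subtype, Submodule.map_subtype_top,
      inf_eq_right.2 (hNle d)] at this
    exact this
  have hdim : Module.finrank ℂ (N d) + Module.finrank ℂ U = Module.finrank ℂ ↥(G ^ (d+1)) := by
    rw [← Submodule.finrank_add_eq_of_isCompl hC]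
    congr 1
    · exact (LinearEquiv.finrank_eq (Submodule.comapSubtypeEquivOfLe (hNle d))).symm
    · exact (LinearEquiv.finrank_eq
        (Submodule.equivMapOfInjective _ (Submodule.injective_subtype _) C)).symm
  have hUd : (G ^ (d + 1)).map (N d).mkQ = U.map (N d).mkQ := by
    rw [← hsup, Submodule.map_sup, Submodule.mkQ_map_self, bot_sup_eq]
  obtain ⟨l, hl, hle⟩ := aux_key G d (N d).mkQ (by
    rw [hUd]
    have := Submodule.finrank_map_le (N d).mkQ U
    have := hN d
    omega)
  have h1 : G ^ (d + 1) ≤ N d ⊔ (G ^ d).map (LinearMap.mulLeft ℂ l) := by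
    intro x hx
    obtain ⟨y, hy, hxy⟩ := hle ⟨x, hx, rfl⟩
    have : x - l * y ∈ N d := by
      rw [← Submodule.Quotient.eq]; exact hxy.symm
    rw [← sub_add_cancel x (l * y)]
    exact Submodule.add_mem_sup this ⟨y, hy, rfl⟩
  have h2 : G ^ (d + 2) ≤ N (d + 1) ⊔ U.map (LinearMap.mulLeft ℂ l) := by
    have hlG : ∀ z ∈ G ^ (d + 1), l * z ∈ N (d + 1) ⊔ U.map (LinearMap.mulLeft ℂ l) := by
      intro z hz
      rw [← hsup] at hz
      obtain ⟨_, ⟨a, ha, rfl⟩, b, hb, rfl⟩ := Submodule.mem_sup.1 hz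
      rw [mul_add]
      refine Submodule.add_mem_sup ⟨l * a, ?_, ?_⟩ ⟨b, hb, rfl⟩
      · rw [SetLike.mem_coe, pow_succ']; exact Submodule.mul_mem_mul hl ha
      · simp [mul_left_comm]
    rw [pow_succ' G (d + 1), Submodule.mul_le]
    intro w hw x hx
    obtain ⟨_, ⟨a, ha, rfl⟩, _, ⟨b, hb, rfl⟩, rfl⟩ := Submodule.mem_sup.1 (h1 hx)
    rw [mul_add]
    refine add_mem (Submodule.mem_sup_left ⟨w * a, ?_, ?_⟩) ?_
    · rw [SetLike.mem_coe, pow_succ']; exact Submodule.mul_mem_mul hw ha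
    · simp [mul_left_comm]
    · have := hlG (w * b) (by rw [pow_succ']; exact Submodule.mul_mem_mul hw hb)
      simpa [mul_left_comm] using this
  have h3 := (Submodule.finrank_mono h2).trans (Submodule.finrank_add_le_finrank_add_finrank _ _)
  have h4 := Submodule.finrank_map_le (LinearMap.mulLeft ℂ l) U
  have h5 := hN d
  have h6 := hN (d + 1)
  omega

/-- Evaluation at representatives as an algebra map. -/
def evZ {m : ℕ} (Z : Finset (Pt m)) : MvPolynomial (Fin (m + 1)) ℂ →ₐ[ℂ] (Z → ℂ) :=
  aeval (fun i P => (P : Pt m).rep i)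

lemma evZ_apply {m : ℕ} (Z : Finset (Pt m)) (F : MvPolynomial (Fin (m + 1)) ℂ) (P : Z) :
    evZ Z F P = eval (P : Pt m).rep F := by
  induction F using MvPolynomial.induction_on with
  | C a => simp [evZ]
  | add p q hp hq => simp [hp, hq]
  | mul_X p i hp => simp [hp]; left; simp [evZ]

lemma hf_eq {m : ℕ} (Z : Finset (Pt m)) (d : ℕ) :
    hf Z d = Module.finrank ℂ
      ↥(((homogeneousSubmodule (Fin (m + 1)) ℂ 1).map (evZ Z).toLinearMap) ^ d) := by
  have : LinearMap.range (evalMap Z d) =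
      ((homogeneousSubmodule (Fin (m + 1)) ℂ 1).map (evZ Z).toLinearMap) ^ d := by
    rw [← Submodule.map_pow, homogeneousSubmodule_one_pow]
    ext y
    constructor
    · rintro ⟨F, rfl⟩
      exact ⟨F.1, F.2, funext fun P => evZ_apply Z F.1 P⟩
    · rintro ⟨F, hF, rfl⟩
      refine ⟨⟨F, hF⟩, ?_⟩
      funext P
      rw [AlgHom.toLinearMap_apply, evZ_apply]
      rfl
  rw [hf, this]

lemma exists_unit_form {m : ℕ} (Z : Finset (Pt m)) :
    ∃ u ∈ (homogeneousSubmodule (Fin (m + 1)) ℂ 1).map (evZ Z).toLinearMap,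
      Function.Injective (LinearMap.mulLeft ℂ u) := by
  obtain ⟨f, hf⟩ := Module.exists_dual_forall_apply_ne_zero (K := ℂ)
    (fun P : Z => (P : Pt m).rep) (fun P => (P : Pt m).rep_nonzero)
  refine ⟨_, ⟨linForm (fun i => f (Pi.single i 1)), ?_, rfl⟩, ?_⟩
  · rw [SetLike.mem_coe, mem_homogeneousSubmodule]
    exact IsHomogeneous.sum _ _ _ fun i _ => isHomogeneous_C_mul_X _ _
  · intro a b hab
    funext P
    have h1 := congrFun hab P
    have h2 : evZ Z (linForm (fun i => f (Pi.single i 1))) P = f (P : Pt m).rep := by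
      rw [evZ_apply, LinearMap.pi_apply_eq_sum_univ f]
      simp only [linForm, map_sum, map_mul, eval_C, eval_X, smul_eq_mul]
      refine Finset.sum_congr rfl fun i _ => ?_
      rw [mul_comm]
      congr 2
      ext k
      simp [Pi.single_apply, eq_comm]
    simp only [LinearMap.mulLeft_apply, Pi.mul_apply, AlgHom.toLinearMap_apply, h2] at h1
    exact mul_left_cancel₀ (hf P) h1

lemma Dhf_step {m : ℕ} (Z : Finset (Pt m)) (j : ℕ) (hj : 0 < j) (h : Dhf Z j ≤ (j : ℤ)) :
    Dhf Z (j + 1) ≤ Dhf Z j := by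
  obtain ⟨d, rfl⟩ : ∃ d, j = d + 1 := ⟨j - 1, by omega⟩
  obtain ⟨u, hu, hinj⟩ := exists_unit_form Z
  have := aux_main_s13 _ u hu hinj d
  rw [← hf_eq, ← hf_eq, ← hf_eq] at this
  simp only [Dhf, Nat.add_sub_cancel, Nat.add_eq_zero_iff, one_ne_zero, and_false, if_false] at h ⊢
  push_cast at h
  have := this (by omega)
  have e : d + 1 + 1 = d + 2 := rfl
  rw [e]
  omega

lemma Dhf_nonneg {m : ℕ} (Z : Finset (Pt m)) (j : ℕ) : 0 ≤ Dhf Z j := by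
  cases j with
  | zero => simp [Dhf]
  | succ d =>
    obtain ⟨u, hu, hinj⟩ := exists_unit_form Z
    simp only [Dhf, Nat.add_sub_cancel, Nat.add_eq_zero_iff, one_ne_zero, and_false, if_false]
    rw [hf_eq, hf_eq, pow_succ', sub_nonneg, Nat.cast_le]
    rw [LinearEquiv.finrank_eq (Submodule.equivMapOfInjective _ hinj _)]
    apply Submodule.finrank_mono
    rintro _ ⟨x, hx, rfl⟩
    exact Submodule.mul_mem_mul hu hx

/-- If `Dh_Z(j) ≤ j` for some `j > 0`, then `Dh_Z(j) ≥ Dh_Z(j+1)`, hence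
`Dh_Z(j) ≥ Dh_Z(i)` for all `i ≥ j`; in particular if `Dh_Z(j) = 0` then `Dh_Z(i) = 0`
for all `i ≥ j`. -/
theorem stmt13 (m : ℕ) (Z : Finset (Pt m)) (j : ℕ) (hj : 0 < j)
    (h : Dhf Z j ≤ (j : ℤ)) :
    Dhf Z (j + 1) ≤ Dhf Z j ∧
      (∀ i : ℕ, j ≤ i → Dhf Z i ≤ Dhf Z j) ∧
      (Dhf Z j = 0 → ∀ i : ℕ, j ≤ i → Dhf Z i = 0) := by
  have key : ∀ i : ℕ, j ≤ i → Dhf Z i ≤ Dhf Z j := by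
    intro i hi
    induction i, hi using Nat.le_induction with
    | base => exact le_rfl
    | succ n hn ih =>
      exact (Dhf_step Z n (by omega) (by omega)).trans ih
  refine ⟨Dhf_step Z j hj h, key, fun h0 i hi => ?_⟩
  exact le_antisymm (h0 ▸ key i hi) (Dhf_nonneg Z i)

end
end
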